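/- arXiv:1504.06071 — 2 statements merged into one kernel-verified Lean document; each statement's English description precedes it below -/
import Mathlib

section
/- Let q be a power of an odd prime and let A = 𝔽_q[T]. Let α = [[a, b], [c, d]] ∈ SL₂(A), let ε be a nonzero element of 𝔽_q, and let r be a positive integer such that b divides a^r − ε in A. Then there exist t⁽¹⁾, …, t⁽¹²⁾ ∈ A, β ∈ M_Λ, and γ ∈ M_Λᵀ such that α^r · t⁽¹⁾_{12} · t⁽²⁾_{21} · t⁽³⁾_{12} · β · t⁽⁴⁾_{12} · t⁽⁵⁾_{21} · t⁽⁶⁾_{12} · t⁽⁷⁾_{21} · γ · t⁽⁸⁾_{21} · t⁽⁹⁾_{12} · t⁽¹⁰⁾_{21} · t⁽¹¹⁾_{12} · t⁽¹²⁾_{21} = [[ε, 0], [0, ε⁻¹]]. -/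
open Polynomial Matrix

/-- The elementary matrix `m_{12} = [[1, m], [0, 1]]`. -/
def m₁₂ {R : Type*} [CommRing R] (m : R) : Matrix (Fin 2) (Fin 2) R := !![1, m; 0, 1]

/-- The elementary matrix `m_{21} = [[1, 0], [m, 1]]`. -/
def m₂₁ {R : Type*} [CommRing R] (m : R) : Matrix (Fin 2) (Fin 2) R := !![1, 0; m, 1]

/-- The set `M_Λ` of products `[[1+ae, be²], [c, 1+de]] · [[1+ae, ce²], [b, 1+de]]`
with `a, b, c, d, e ∈ R` such that the first factor has determinant `1`. -/
def MLambda (R : Type*) [CommRing R] : Set (Matrix (Fin 2) (Fin 2) R) :=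
  {x | ∃ a b c d e : R,
    (!![1 + a * e, b * e ^ 2; c, 1 + d * e] : Matrix (Fin 2) (Fin 2) R).det = 1 ∧
    x = !![1 + a * e, b * e ^ 2; c, 1 + d * e] * !![1 + a * e, c * e ^ 2; b, 1 + d * e]}

/-- `M_Λᵀ`: the set of transposes of elements of `M_Λ`. -/
def MLambdaT (R : Type*) [CommRing R] : Set (Matrix (Fin 2) (Fin 2) R) :=
  {x | ∃ y ∈ MLambda R, x = yᵀ}

theorem IsCoprime.exists_dvd_sub_dvd_sub {R : Type*} [CommRing R] {x y : R} (h : IsCoprime x y)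
    (a b : R) : ∃ c, x ∣ c - a ∧ y ∣ c - b := by
  obtain ⟨u, v, huv⟩ := h
  exact ⟨a * (v * y) + b * (u * x), ⟨b * u - a * u, by linear_combination a * huv⟩,
    ⟨a * v - b * v, by linear_combination b * huv⟩⟩

/-- If `p`, `m`, `n` have no common prime factor, then `p` is congruent modulo `m` to an element
coprime to `n`. -/
theorem exists_isCoprime_add_mul {R : Type*} [CommRing R] [IsDomain R] [IsPrincipalIdealRing R]
    {p m n : R} (hn : n ≠ 0) (h : ∀ π, Prime π → π ∣ p → π ∣ m → ¬ π ∣ n) :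
    ∃ t, IsCoprime (p + m * t) n := by
  induction n using UniqueFactorizationMonoid.induction_on_coprime with
  | h0 => exact absurd rfl hn
  | h1 hx => exact ⟨0, isCoprime_one_right.of_isCoprime_of_dvd_right hx.dvd⟩
  | @hpr π i hπ =>
    rcases Nat.eq_zero_or_pos i with rfl | hi
    · exact ⟨0, by simpa using isCoprime_one_right⟩
    have hdiv : π ∣ π ^ i := dvd_pow_self π hi.ne'
    suffices ∃ t, ¬ π ∣ p + m * t by
      obtain ⟨t, ht⟩ := this
      exact ⟨t, ((hπ.irreducible.coprime_iff_not_dvd.2 ht).symm).pow_right⟩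
    by_cases hp : π ∣ p
    · refine ⟨1, fun hd => h π hπ hp ?_ hdiv⟩
      simpa using (dvd_add_right hp).1 hd
    · exact ⟨0, by simpa using hp⟩
  | @hcp x y hxy hx hy =>
    obtain ⟨t₁, h₁⟩ := hx (left_ne_zero_of_mul hn)
      fun π hπ hp hm hd => h π hπ hp hm (hd.mul_right y)
    obtain ⟨t₂, h₂⟩ := hy (right_ne_zero_of_mul hn)
      fun π hπ hp hm hd => h π hπ hp hm (hd.mul_left x)
    obtain ⟨t, ⟨u, hu⟩, ⟨v, hv⟩⟩ := hxy.isCoprime.exists_dvd_sub_dvd_sub t₁ t₂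
    refine ⟨t, IsCoprime.mul_right ?_ ?_⟩
    · rw [show p + m * t = p + m * t₁ + x * (m * u) by linear_combination m * hu]
      exact IsCoprime.add_mul_left_left h₁ _
    · rw [show p + m * t = p + m * t₂ + y * (m * v) by linear_combination m * hv]
      exact IsCoprime.add_mul_left_left h₂ _

section FiniteField

variable {F : Type*} [Field F] [Fintype F]

theorem two_ne_zero_of_odd_card (hq : Odd (Fintype.card F)) : (2 : F) ≠ 0 := by
  intro h
  have : ringChar F = 2 := by
    have h2 : ringChar F ∣ 2 := ringChar.dvd (by exact_mod_cast h)
    exact ((Nat.dvd_prime Nat.prime_two).1 h2).resolve_left (CharP.ringChar_ne_one)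
  have := FiniteField.even_card_of_char_two this
  rw [Nat.odd_iff] at hq
  omega

/-- The binary form `p² - k q²` with `k ≠ 0` is universal over a finite field of odd order. -/
theorem exists_sq_sub_mul_sq (hq : Odd (Fintype.card F)) {k : F} (hk : k ≠ 0) (w : F) :
    ∃ p q : F, p ^ 2 - k * q ^ 2 = w := by
  obtain ⟨p, q, h⟩ := FiniteField.exists_root_sum_quadratic
    (f := X ^ 2 - C w) (g := C (-k) * X ^ 2) (degree_X_pow_sub_C two_pos w)
    (degree_C_mul_X_pow 2 (neg_ne_zero.2 hk)) (Nat.odd_iff.1 hq)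
  refine ⟨p, q, ?_⟩
  simp only [eval_sub, eval_pow, eval_X, eval_C, eval_mul] at h
  linear_combination h

theorem exists_dvd_sq_sub_mul_sq_sub_of_prime (hq : Odd (Fintype.card F)) {π k : F[X]}
    (hπ : Prime π) (hk : ¬ π ∣ k) (w : F[X]) : ∃ p q, π ∣ p ^ 2 - k * q ^ 2 - w := by
  have := Fact.mk hπ.irreducible
  have := (AdjoinRoot.powerBasis hπ.ne_zero).finite
  have := Module.finite_of_finite F (M := AdjoinRoot π)
  have := Fintype.ofFinite (AdjoinRoot π)
  have hodd : Odd (Fintype.card (AdjoinRoot π)) := by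
    rw [Module.card_eq_pow_finrank (K := F)]
    exact hq.pow
  obtain ⟨p', q', h⟩ := exists_sq_sub_mul_sq hodd (mt AdjoinRoot.mk_eq_zero.1 hk)
    (AdjoinRoot.mk π w)
  obtain ⟨p, rfl⟩ := AdjoinRoot.mk_surjective p'
  obtain ⟨q, rfl⟩ := AdjoinRoot.mk_surjective q'
  refine ⟨p, q, AdjoinRoot.mk_eq_zero.1 ?_⟩
  simp [h]

theorem exists_pow_dvd_sq_sub_mul_sq_sub (hq : Odd (Fintype.card F)) {π k w : F[X]}
    (hπ : Prime π) (hk : ¬ π ∣ k) (hw : ¬ π ∣ w) (n : ℕ) :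
    ∃ p q, π ^ (n + 1) ∣ p ^ 2 - k * q ^ 2 - w := by
  have h2 : ¬ π ∣ 2 := fun h => hπ.not_isUnit <| isUnit_of_dvd_unit h <| by
    exact_mod_cast (isUnit_C (R := F)).2 (two_ne_zero_of_odd_card hq).isUnit
  induction n with
  | zero => simpa using exists_dvd_sq_sub_mul_sq_sub_of_prime hq hπ hk w
  | succ n ih =>
    obtain ⟨p, q, c, hc⟩ := ih
    by_cases hp : π ∣ p
    · have hkq : ¬ π ∣ 2 * k * q := by
        intro h
        rcases hπ.dvd_or_dvd h with h | h
        · exact (hπ.dvd_or_dvd h).elim h2 hk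
        · refine hw ?_
          rw [show w = p * p - q * (k * q) - π ^ n * c * π by linear_combination -hc]
          exact ((hp.mul_right _).sub (h.mul_right _)).sub (dvd_mul_left _ _)
      obtain ⟨u, v, huv⟩ := hπ.irreducible.coprime_iff_not_dvd.2 hkq
      refine ⟨p, q + π ^ (n + 1) * (v * c), u * c - k * π ^ n * v ^ 2 * c ^ 2, ?_⟩
      linear_combination hc - π ^ (n + 1) * c * huv
    · obtain ⟨u, v, huv⟩ := hπ.irreducible.coprime_iff_not_dvd.2
        (fun h => (hπ.dvd_or_dvd h).elim h2 hp : ¬ π ∣ 2 * p)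
      refine ⟨p - π ^ (n + 1) * (v * c), q, u * c + π ^ n * v ^ 2 * c ^ 2, ?_⟩
      linear_combination hc - π ^ (n + 1) * c * huv

theorem exists_dvd_sq_sub_mul_sq_sub (hq : Odd (Fintype.card F)) {m k w : F[X]}
    (hm : m ≠ 0) (hk : IsCoprime m k) (hw : IsCoprime m w) :
    ∃ p q, m ∣ p ^ 2 - k * q ^ 2 - w := by
  induction m using UniqueFactorizationMonoid.induction_on_coprime with
  | h0 => exact absurd rfl hm
  | h1 hx => exact ⟨0, 0, hx.dvd⟩
  | @hpr π i hπ =>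
    cases i with
    | zero => exact ⟨0, 0, by simp⟩
    | succ n =>
      refine exists_pow_dvd_sq_sub_mul_sq_sub hq hπ ?_ ?_ n
      · exact hπ.irreducible.coprime_iff_not_dvd.1
          (hk.of_isCoprime_of_dvd_left (dvd_pow_self π n.succ_ne_zero))
      · exact hπ.irreducible.coprime_iff_not_dvd.1
          (hw.of_isCoprime_of_dvd_left (dvd_pow_self π n.succ_ne_zero))
  | @hcp x y hxy hx hy =>
    obtain ⟨p₁, q₁, h₁⟩ := hx (left_ne_zero_of_mul hm) hk.of_mul_left_left hw.of_mul_left_left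
    obtain ⟨p₂, q₂, h₂⟩ := hy (right_ne_zero_of_mul hm) hk.of_mul_left_right hw.of_mul_left_right
    obtain ⟨p, hp₁, hp₂⟩ := hxy.isCoprime.exists_dvd_sub_dvd_sub p₁ p₂
    obtain ⟨q, hq₁, hq₂⟩ := hxy.isCoprime.exists_dvd_sub_dvd_sub q₁ q₂
    refine ⟨p, q, hxy.isCoprime.mul_dvd ?_ ?_⟩
    · rw [show p ^ 2 - k * q ^ 2 - w = (p₁ ^ 2 - k * q₁ ^ 2 - w) + (p - p₁) * (p + p₁)
        - (q - q₁) * (k * (q + q₁)) by ring]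
      exact (h₁.add (hp₁.mul_right _)).sub (hq₁.mul_right _)
    · rw [show p ^ 2 - k * q ^ 2 - w = (p₂ ^ 2 - k * q₂ ^ 2 - w) + (p - p₂) * (p + p₂)
        - (q - q₂) * (k * (q + q₂)) by ring]
      exact (h₂.add (hp₂.mul_right _)).sub (hq₂.mul_right _)

/-- Every residue class `w` modulo `m` prime to `m` contains an element modulo which a given `k`
prime to `m` is a square. It is found among the primitive values of `p² - k q²`. -/
theorem exists_add_mul_dvd_sq_sub (hq : Odd (Fintype.card F)) {m k w : F[X]}
    (hk : IsCoprime m k) (hw : IsCoprime m w) :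
    ∃ t f, w + t * m ∣ f ^ 2 - k := by
  rcases eq_or_ne m 0 with rfl | hm
  · exact ⟨0, 0, by simpa using (isCoprime_zero_left.1 hw).dvd⟩
  obtain ⟨p, q, hpq, hq0⟩ : ∃ p q, m ∣ p ^ 2 - k * q ^ 2 - w ∧ q ≠ 0 := by
    obtain ⟨p, q, h⟩ := exists_dvd_sq_sub_mul_sq_sub hq hm hk hw
    rcases eq_or_ne q 0 with rfl | hq0
    · refine ⟨p, m, ?_, hm⟩
      rw [show p ^ 2 - k * m ^ 2 - w = (p ^ 2 - k * 0 ^ 2 - w) - m * (k * m) by ring]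
      exact h.sub (dvd_mul_right _ _)
    · exact ⟨p, q, h, hq0⟩
  obtain ⟨s, u, v, huv⟩ : ∃ s, IsCoprime (p + m * s) q := by
    refine exists_isCoprime_add_mul hq0 fun π hπ hp hm hq => ?_
    refine hπ.not_isUnit (hw.isUnit_of_dvd' hm ?_)
    rw [show w = p * p - q * (k * q) - (p ^ 2 - k * q ^ 2 - w) by ring]
    exact ((hp.mul_right _).sub (hq.mul_right _)).sub (hm.trans hpq)
  obtain ⟨c, hc⟩ := hpq
  -- With `P = p + m s` and `u P + v q = 1`, the square root of `k` is `k q u + P v`.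
  refine ⟨c + 2 * p * s + m * s ^ 2, k * q * u + (p + m * s) * v, v ^ 2 - k * u ^ 2, ?_⟩
  linear_combination (v ^ 2 - k * u ^ 2) * hc + k * (u * (p + m * s) + v * q + 1) * huv

end FiniteField

theorem fin_two_ext {R : Type*} {a b c d a' b' c' d' : R} (ha : a = a') (hb : b = b')
    (hc : c = c') (hd : d = d') : !![a, b; c, d] = !![a', b'; c', d'] := by
  rw [ha, hb, hc, hd]

section RowReduction

variable {R : Type*} [CommRing R]

theorem fin_two_mul_m₁₂ (a b c d t : R) :
    !![a, b; c, d] * m₁₂ t = !![a, b + a * t; c, d + c * t] := by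
  simp [m₁₂, add_comm]

theorem fin_two_mul_m₂₁ (a b c d t : R) :
    !![a, b; c, d] * m₂₁ t = !![a + b * t, b; c + d * t, d] := by
  simp [m₂₁]

theorem m₂₁_mul_m₂₁ (s t : R) : m₂₁ s * m₂₁ t = m₂₁ (s + t) := by
  simp [m₂₁]

/-- Simultaneous exchange of the two rows and the two columns. -/
def swapRingEquiv (R : Type*) [CommRing R] :
    Matrix (Fin 2) (Fin 2) R ≃+* Matrix (Fin 2) (Fin 2) R :=
  (Matrix.reindexAlgEquiv R R (Equiv.swap (0 : Fin 2) 1)).toRingEquiv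

theorem swapRingEquiv_apply (a b c d : R) :
    swapRingEquiv R !![a, b; c, d] = !![d, c; b, a] := by
  ext i j
  fin_cases i <;> fin_cases j <;> simp [swapRingEquiv]

theorem swapRingEquiv_m₁₂ (t : R) : swapRingEquiv R (m₁₂ t) = m₂₁ t := swapRingEquiv_apply _ _ _ _

theorem swapRingEquiv_m₂₁ (t : R) : swapRingEquiv R (m₂₁ t) = m₁₂ t := swapRingEquiv_apply _ _ _ _

theorem swapRingEquiv_mem_MLambdaT {x : Matrix (Fin 2) (Fin 2) R} (hx : x ∈ MLambda R) :
    swapRingEquiv R x ∈ MLambdaT R := by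
  obtain ⟨a, b, c, d, e, hdet, rfl⟩ := hx
  refine ⟨_, ⟨d, c, b, a, e, ?_, rfl⟩, ?_⟩
  · rw [Matrix.det_fin_two_of] at hdet ⊢
    linear_combination hdet
  · rw [map_mul, swapRingEquiv_apply, swapRingEquiv_apply, Matrix.transpose_mul]
    congr 1 <;> ext i j <;> fin_cases i <;> fin_cases j <;> rfl

/-- Multiplying the inverse of the first factor of an element of `M_Λ` by that element leaves the
second factor. -/
theorem exists_mem_MLambda_mul_eq {P w e k c s : R} (hP : P = 1 + k * e)
    (hdet : P * s + w * e ^ 2 * c = 1) :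
    ∃ β ∈ MLambda R, !![P, -(w * e ^ 2); c, s] * β = !![s, -(c * e ^ 2); w, P] := by
  have hs : 1 + (-(k * s) - w * e * c) * e = s := by
    linear_combination -hdet + s * hP
  refine ⟨_, ⟨-(k * s) - w * e * c, w, -c, k, e, ?_, rfl⟩, ?_⟩
  · rw [hs, ← hP, Matrix.det_fin_two_of]
    linear_combination hdet
  · rw [hs, ← hP, ← Matrix.mul_assoc]
    have : !![P, -(w * e ^ 2); c, s] * !![s, w * e ^ 2; -c, P] = 1 := by
      rw [Matrix.mul_fin_two, Matrix.one_fin_two]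
      refine fin_two_ext ?_ ?_ ?_ ?_
      · linear_combination hdet
      · ring
      · ring
      · linear_combination hdet
    rw [this, Matrix.one_mul, neg_mul]

end RowReduction

section RemoveFactor

variable {F : Type*} [Field F] [Fintype F]

/-- A factor `e` with `P ≡ 1 mod e` can be removed from the first row `(P, e w)`, which then becomes
the second row `(w, P)`. -/
theorem exists_first_row_to_second_row (hq : Odd (Fintype.card F)) {P e w c s : F[X]}
    (hdet : P * s - e * w * c = 1) (he : e ∣ P - 1) :
    ∃ t₁ t₂ t₃ t₄ t₅ : F[X], ∃ β ∈ MLambda F[X], ∃ u v : F[X],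
      u * P - v * w = 1 ∧
      !![P, e * w; c, s] * m₁₂ t₁ * m₂₁ t₂ * m₁₂ t₃ * β * m₁₂ t₄ * m₂₁ t₅ =
        !![u, v; w, P] := by
  obtain ⟨k, hk⟩ := he
  obtain ⟨t, f, g, hg⟩ := exists_add_mul_dvd_sq_sub hq (m := P) (k := k) (w := w)
    ⟨1, -e, by linear_combination hk⟩ ⟨s, -(e * c), by linear_combination hdet⟩
  set w' := w + t * P with hw'
  set P' := P + e * w' * g with hP'
  have hP'f : P' = 1 + f * (e * f) := by linear_combination hP' + hk - e * hg
  set s₁ := s + c * (e * t)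
  set c₁ := c + s₁ * g
  set s₂ := s₁ + c₁ * (-(e * w'))
  have hrow : !![P, e * w; c, s] * m₁₂ (e * t) * m₂₁ g * m₁₂ (-(e * w')) =
      !![P', -(w' * (e * f) ^ 2); c₁, s₂] := by
    rw [fin_two_mul_m₁₂, fin_two_mul_m₂₁, fin_two_mul_m₁₂]
    have h₁ : P + (e * w + P * (e * t)) * g = P' := by rw [hP', hw']; ring
    have h₂ : e * w + P * (e * t) + P' * (-(e * w')) = -(w' * (e * f) ^ 2) := by
      linear_combination (-(e * w')) * hP'f - e * hw'
    rw [h₁, h₂]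
  have hdet' : P' * s₂ + w' * (e * f) ^ 2 * c₁ = 1 := by
    have := congrArg Matrix.det hrow
    simp only [m₁₂, m₂₁, Matrix.det_mul, Matrix.det_fin_two_of] at this
    linear_combination hdet - this
  obtain ⟨β, hβ, h⟩ := exists_mem_MLambda_mul_eq hP'f hdet'
  refine ⟨e * t, g, -(e * w'), -(e * g), -t, β, hβ,
    s₂ + (-(c₁ * (e * f) ^ 2) + s₂ * (-(e * g))) * (-t),
    -(c₁ * (e * f) ^ 2) + s₂ * (-(e * g)), ?_, ?_⟩
  · linear_combination hdet' - s₂ * hP' + (-(c₁ * (e * f) ^ 2) + s₂ * (-(e * g))) * hw'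
  · rw [hrow, h, fin_two_mul_m₁₂, fin_two_mul_m₂₁]
    have h₁ : P' + w' * (-(e * g)) = P := by linear_combination hP'
    have h₂ : w' + P * (-t) = w := by linear_combination hw'
    rw [h₁, h₂]

/-- A factor `e` with `P ≡ 1 mod e` can be removed from the second row `(e w, P)`, which then
becomes the first row `(P, w)`. -/
theorem exists_second_row_to_first_row (hq : Odd (Fintype.card F)) {P e w c s : F[X]}
    (hdet : P * s - e * w * c = 1) (he : e ∣ P - 1) :
    ∃ t₁ t₂ t₃ t₄ t₅ : F[X], ∃ γ ∈ MLambdaT F[X], ∃ u v : F[X],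
      u * P - v * w = 1 ∧
      !![s, c; e * w, P] * m₂₁ t₁ * m₁₂ t₂ * m₂₁ t₃ * γ * m₂₁ t₄ * m₁₂ t₅ =
        !![P, w; v, u] := by
  obtain ⟨t₁, t₂, t₃, t₄, t₅, β, hβ, u, v, huv, h⟩ := exists_first_row_to_second_row hq hdet he
  refine ⟨t₁, t₂, t₃, t₄, t₅, _, swapRingEquiv_mem_MLambdaT hβ, u, v, huv, ?_⟩
  simpa only [map_mul, swapRingEquiv_apply, swapRingEquiv_m₁₂, swapRingEquiv_m₂₁] using
    congrArg (swapRingEquiv F[X]) h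

end RemoveFactor

section Power

variable {R : Type*} [CommRing R]

theorem exists_fin_two_pow_eq {a b c d : R} (hdet : a * d - b * c = 1) (r : ℕ) :
    ∃ x y : R, !![a, b; c, d] ^ r = !![x * a + y, x * b; x * c, x * d + y] := by
  induction r with
  | zero => exact ⟨0, 1, by simp [Matrix.one_fin_two]⟩
  | succ r ih =>
    obtain ⟨x, y, h⟩ := ih
    refine ⟨x * (a + d) + y, -x, ?_⟩
    rw [pow_succ, h, Matrix.mul_fin_two]
    refine fin_two_ext ?_ ?_ ?_ ?_
    · linear_combination -x * hdet
    · ring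
    · ring
    · linear_combination -x * hdet

theorem dvd_fin_two_pow_apply (a b c d : R) (r : ℕ) :
    b ∣ (!![a, b; c, d] ^ r) 0 1 ∧ b ∣ (!![a, b; c, d] ^ r) 0 0 - a ^ r := by
  induction r with
  | zero => simp
  | succ r ih =>
    obtain ⟨⟨u, hu⟩, ⟨v, hv⟩⟩ := ih
    rw [pow_succ, Matrix.mul_apply, Matrix.mul_apply, Fin.sum_univ_two, Fin.sum_univ_two, hu]
    refine ⟨⟨(!![a, b; c, d] ^ r) 0 0 + u * d, ?_⟩, ⟨v * a + u * c, ?_⟩⟩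
    · simp; ring
    · simp; linear_combination a * hv

end Power

/-- Lemma 3.3: with `A = 𝔽_q[T]` (`q` a power of an odd prime), let
`α = [[a, b], [c, d]] ∈ SL₂(A)`, let `ε ∈ 𝔽_q` be nonzero, and let `r ≥ 1` be such that
`b ∣ a^r − ε` in `A`.  Then there exist `t⁽¹⁾, …, t⁽¹²⁾ ∈ A`, `β ∈ M_Λ`, and
`γ ∈ M_Λᵀ` such that `α^r · t⁽¹⁾_{12} · t⁽²⁾_{21} · t⁽³⁾_{12} · β · t⁽⁴⁾_{12} ·
t⁽⁵⁾_{21} · t⁽⁶⁾_{12} · t⁽⁷⁾_{21} · γ · t⁽⁸⁾_{21} · t⁽⁹⁾_{12} · t⁽¹⁰⁾_{21} ·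
t⁽¹¹⁾_{12} · t⁽¹²⁾_{21} = [[ε, 0], [0, ε⁻¹]]`. -/
theorem lemma_power_diagonal
    (F : Type) [Field F] [Fintype F] (hq : Odd (Fintype.card F))
    (a b c d : Polynomial F)
    (hdet : (!![a, b; c, d] : Matrix (Fin 2) (Fin 2) (Polynomial F)).det = 1)
    (ε : F) (hε : ε ≠ 0) (r : ℕ) (hr : 1 ≤ r) (hdvd : b ∣ a ^ r - C ε) :
    ∃ t : Fin 12 → Polynomial F,
      ∃ β ∈ MLambda (Polynomial F), ∃ γ ∈ MLambdaT (Polynomial F),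
        (!![a, b; c, d] : Matrix (Fin 2) (Fin 2) (Polynomial F)) ^ r *
            m₁₂ (t 0) * m₂₁ (t 1) * m₁₂ (t 2) * β * m₁₂ (t 3) * m₂₁ (t 4) *
            m₁₂ (t 5) * m₂₁ (t 6) * γ * m₂₁ (t 7) * m₁₂ (t 8) * m₂₁ (t 9) *
            m₁₂ (t 10) * m₂₁ (t 11) =
          !![C ε, 0; 0, C ε⁻¹] := by
  have hdet₀ : a * d - b * c = 1 := by rwa [Matrix.det_fin_two_of] at hdet
  obtain ⟨x, y, hpow⟩ := exists_fin_two_pow_eq hdet₀ r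
  have hdetr : (x * a + y) * (x * d + y) - x * b * (x * c) = 1 := by
    rw [← Matrix.det_fin_two_of, ← hpow, Matrix.det_pow, hdet, one_pow]
  obtain ⟨h, hh⟩ : b ∣ x * a + y - C ε := by
    have := (dvd_fin_two_pow_apply a b c d r).2.add hdvd
    rw [hpow] at this
    simpa using this
  obtain ⟨x₁, x₂, ⟨y₁, hy₁⟩, ⟨y₂, hy₂⟩, rfl⟩ : ∃ x₁ x₂, x₁ ∣ y - 1 ∧ x₂ ∣ y + 1 ∧ x = x₁ * x₂ :=
    exists_dvd_and_dvd_of_dvd_mul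
      ⟨-(x + y * (a + d)), by linear_combination hdetr - x ^ 2 * hdet₀⟩
  rw [hpow]
  generalize hP : x₁ * x₂ * a + y = P at *
  obtain ⟨t₁, t₂, t₃, t₄, t₅, β, hβ, u, v, huv, hβeq⟩ :=
    exists_first_row_to_second_row hq (P := P) (e := x₁) (w := x₂ * b)
      (c := x₁ * x₂ * c) (s := x₁ * x₂ * d + y) (by linear_combination hdetr)
      ⟨x₂ * a + y₁, by linear_combination hy₁ - hP⟩
  obtain ⟨s₁, s₂, s₃, s₄, s₅, γ, hγ, u', v', huv', hγeq⟩ :=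
    exists_second_row_to_first_row hq (P := -P) (e := x₂) (w := -b) (c := -v) (s := -u)
      (by linear_combination huv) ⟨-(x₁ * a + y₂), by linear_combination hP - hy₂⟩
  have hC : C ε * C ε⁻¹ = (1 : F[X]) := by rw [← C_mul, mul_inv_cancel₀ hε, C_1]
  have hγeq' : !![u, v; x₂ * b, P] * m₂₁ s₁ * m₁₂ s₂ * m₂₁ s₃ * γ * m₂₁ s₄ * m₁₂ s₅ =
      !![P, b; -v', -u'] := by
    have hneg : !![u, v; x₂ * b, P] = -!![-u, -v; x₂ * -b, -P] := by simp
    rw [hneg]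
    simp only [Matrix.neg_mul, hγeq]
    simp
  refine ⟨![t₁, t₂, t₃, t₄, t₅ + s₁, s₂, s₃, s₄, s₅, -h, -(C ε⁻¹ * b), C ε * (v' - u' * h)],
    β, hβ, γ, hγ, ?_⟩
  have hsplit : m₂₁ (t₅ + s₁) = m₂₁ t₅ * m₂₁ s₁ := (m₂₁_mul_m₂₁ _ _).symm
  simp only [Matrix.cons_val]
  rw [hsplit, ← Matrix.mul_assoc _ (m₂₁ t₅), mul_assoc x₁ x₂ b, hβeq, hγeq', fin_two_mul_m₂₁,
    fin_two_mul_m₁₂, fin_two_mul_m₂₁]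
  have h₁ : P + b * -h = C ε := by linear_combination hh
  have h₂ : b + C ε * -(C ε⁻¹ * b) = 0 := by linear_combination -b * hC
  have h₃ : -u' + (-v' + -u' * -h) * -(C ε⁻¹ * b) = C ε⁻¹ := by
    linear_combination C ε⁻¹ * huv' + C ε⁻¹ * u' * hh + u' * hC
  rw [h₁, h₂, h₃]
  refine fin_two_ext ?_ rfl ?_ rfl
  · ring
  · linear_combination (v' - u' * h) * hC
end

section
/- Let q be a power of an odd prime and let A = 𝔽_q[T]. Then every α ∈ SL₂(A) can be represented as α = χ₉ · γ · χ₄ · β · χ₁₁♡ · γ♡ · χ₄♡ · β♡ · χ₄# where χ₄ ∈ G₄(A⁴), χ₉ ∈ G₉(A⁹), χ₄♡ ∈ F₄(A⁴), χ₁₁♡ ∈ F₁₁(A¹¹), χ₄# ∈ G₄(A⁴), γ♡, β ∈ M_Λ, and γ, β♡ ∈ M_Λᵀ. -/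
open Polynomial Matrix

/-- The matrix `J = [[0, 1], [−1, 0]]`. -/
def Jmat (R : Type*) [CommRing R] : Matrix (Fin 2) (Fin 2) R := !![0, 1; -1, 0]

/-- `F_r(m₁, …, m_r)`: the alternating product whose `k`-th factor (k = 1, …, r) is
`(m_k)_{12}` for odd `k` and `(m_k)_{21}` for even `k`. -/
def Fmat {R : Type*} [CommRing R] (r : ℕ) (m : Fin r → R) : Matrix (Fin 2) (Fin 2) R :=
  ((List.finRange r).map (fun k => if k.val % 2 = 0 then m₁₂ (m k) else m₂₁ (m k))).prod

/-- `G_r(m₁, …, m_r) = J · F_r(m₁, …, m_r) · J⁻¹`. -/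
noncomputable def Gmat {R : Type*} [CommRing R] (r : ℕ) (m : Fin r → R) :
    Matrix (Fin 2) (Fin 2) R :=
  Jmat R * Fmat r m * (Jmat R)⁻¹

/-- `F_r(A^r)`: the set of values of `F_r` as `m₁, …, m_r` range over `R`. -/
def FSet (R : Type*) [CommRing R] (r : ℕ) : Set (Matrix (Fin 2) (Fin 2) R) :=
  Set.range (fun m : Fin r → R => Fmat r m)

/-- `G_r(A^r)`: the set of values of `G_r` as `m₁, …, m_r` range over `R`. -/
def GSet (R : Type*) [CommRing R] (r : ℕ) : Set (Matrix (Fin 2) (Fin 2) R) :=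
  Set.range (fun m : Fin r → R => Gmat r m)


/-- Any determinant one matrix whose corner is a unit is a product of four elementary matrices. -/
lemma eq_prod_elementary_of_corner_unit {R : Type*} [CommRing R] {z w b y d : R}
    (hz : z * w = 1) (h : z * d - b * y = 1) :
    !![z, b; y, d] = m₂₁ ((y - (z - 1)) * w) * m₁₂ 1 * m₂₁ (z - 1) * m₁₂ ((b - 1) * w) := by
  have hd : d = w * (1 + b * y) := by linear_combination (-d) * hz + w * h
  subst hd
  ext i j
  fin_cases i <;> fin_cases j <;> simp [m₁₂, m₂₁, Matrix.mul_apply, Fin.sum_univ_two]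
  · linear_combination (1 - b) * hz
  · linear_combination (z - 1 - y) * hz
  · linear_combination (1 - (1 - b) * (z - 1 - y) * w) * hz

lemma exists_chebyshev_pair {R : Type*} [CommRing R] {x b y d : R} (h : x * d - b * y = 1)
    (k : ℕ) : ∃ u v : R, u ^ 2 + v ^ 2 - (x + d) * u * v = 1 ∧
      b * y ∣ x ^ (k + 1) - (u * x - v) ∧ b * y ∣ x ^ k - (v * x - ((x + d) * v - u)) := by
  induction k with
  | zero => exact ⟨1, 0, by ring, by simp, by simp⟩
  | succ k ih =>
    obtain ⟨u, v, huv, h1, h2⟩ := ih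
    refine ⟨(x + d) * u - v, u, by linear_combination huv, ?_, ?_⟩
    · obtain ⟨c, hc⟩ := h1
      exact ⟨x * c - u, by linear_combination x * hc - u * h⟩
    · convert h1 using 1
      ring

/-- Twisting by a power: the matrices `!![s, b; y g², s']` and `!![s, b g²; y, s']`, where `s` is
congruent to an odd power of the corner of `!![x, b; y, d]`, differ by elements of `MLambdaT` and
`MLambda`. -/
lemma exists_MLambda_swap {R : Type*} [CommRing R] {x b y d : R} (h : x * d - b * y = 1)
    {m : ℕ} (hm : Odd m) : ∃ s s' g : R, b * y ∣ x ^ m - s ∧ s * s' - b * (y * g ^ 2) = 1 ∧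
      ∃ γ ∈ MLambdaT R, ∃ β ∈ MLambda R,
        !![s, b; y * g ^ 2, s'] = γ * β * !![s, b * g ^ 2; y, s'] := by
  obtain ⟨k, rfl⟩ := hm
  obtain ⟨u, v, huv, h1, h2⟩ := exists_chebyshev_pair h k
  set t := x + d with ht
  set f := v * (t * v - 2 * u) with hf
  have hf1 : f - 1 = (u + v) * (t * v - u - v) := by linear_combination hf + huv
  have hf2 : f + 1 = (u - v) * (u - v - t * v) := by linear_combination hf - huv
  have hfg : f ^ 2 + f * (u ^ 2 - v ^ 2) * t + (u ^ 2 - v ^ 2) ^ 2 = 1 := by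
    linear_combination (f + v * (t * v - 2 * u) + (u ^ 2 - v ^ 2) * t) * hf +
      (u ^ 2 + v ^ 2 - t * u * v + 1) * huv
  have hdet : (f + (u ^ 2 - v ^ 2) * x) * (f + (u ^ 2 - v ^ 2) * d)
      - b * (y * (u ^ 2 - v ^ 2) ^ 2) = 1 := by
    linear_combination hfg + (u ^ 2 - v ^ 2) ^ 2 * h
  refine ⟨f + (u ^ 2 - v ^ 2) * x, f + (u ^ 2 - v ^ 2) * d, u ^ 2 - v ^ 2, ?_, hdet, ?_⟩
  · have hx : x ^ (2 * k + 1) - (f + (u ^ 2 - v ^ 2) * x) =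
        x ^ k * (x ^ (k + 1) - (u * x - v)) +
          (u * x - v) * (x ^ k - (v * x - (t * v - u))) - u * v * (b * y) := by
      rw [hf, ht]
      linear_combination (-(u * v)) * h
    rw [hx]
    exact dvd_sub (dvd_add (h1.mul_left _) (h2.mul_left _)) (Dvd.intro_left _ rfl)
  · set s := f + (u ^ 2 - v ^ 2) * x with hs
    set s' := f + (u ^ 2 - v ^ 2) * d with hs'
    have hs1 : s = 1 + (t * v - u - v + (u - v) * x) * (u + v) := by
      linear_combination hs + hf1
    have hs1' : s' = 1 + (t * v - u - v + (u - v) * d) * (u + v) := by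
      linear_combination hs' + hf1
    have hs2 : -s = 1 + (-(u - v - t * v) - (u + v) * x) * (u - v) := by
      linear_combination -hs - hf2
    have hs2' : -s' = 1 + (-(u - v - t * v) - (u + v) * d) * (u - v) := by
      linear_combination -hs' - hf2
    clear_value s s'
    refine ⟨!![s, b; y * (u ^ 2 - v ^ 2) ^ 2, s'] * !![s, y * (u - v) ^ 2; b * (u + v) ^ 2, s'],
      ⟨_, ⟨t * v - u - v + (u - v) * x, b, y * (u - v) ^ 2, t * v - u - v + (u - v) * d, u + v,
        ?_, rfl⟩, ?_⟩,
      !![-s', y * (u - v) ^ 2; b * (u + v) ^ 2, -s] *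
        !![-s', b * (u ^ 2 - v ^ 2) ^ 2; y, -s],
      ⟨-(u - v - t * v) - (u + v) * d, y, b * (u + v) ^ 2, -(u - v - t * v) - (u + v) * x,
        u - v, ?_, ?_⟩, ?_⟩
    · rw [Matrix.det_fin_two_of, ← hs1, ← hs1']
      linear_combination hdet
    · rw [← hs1, ← hs1', Matrix.transpose_mul]
      ext i j
      fin_cases i <;> fin_cases j <;> simp [Matrix.mul_apply, Fin.sum_univ_two] <;> ring
    · rw [Matrix.det_fin_two_of, ← hs2, ← hs2']
      linear_combination hdet
    · rw [← hs2, ← hs2', show b * (u + v) ^ 2 * (u - v) ^ 2 = b * (u ^ 2 - v ^ 2) ^ 2 by ring]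
    · have e1 : !![-s', b * (u ^ 2 - v ^ 2) ^ 2; y, -s] * !![s, b * (u ^ 2 - v ^ 2) ^ 2; y, s'] =
          -1 := by
        ext i j
        fin_cases i <;> fin_cases j <;> simp [Matrix.mul_apply, Fin.sum_univ_two] <;>
          first | ring1 | linear_combination (-1 : R) * hdet
      have e2 : !![s, y * (u - v) ^ 2; b * (u + v) ^ 2, s'] *
          !![-s', y * (u - v) ^ 2; b * (u + v) ^ 2, -s] = -1 := by
        ext i j
        fin_cases i <;> fin_cases j <;> simp [Matrix.mul_apply, Fin.sum_univ_two] <;>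
          first | ring1 | linear_combination (-1 : R) * hdet
      rw [← Matrix.mul_assoc, Matrix.mul_assoc _ _ !![s, b * _; y, s'], e1,
        Matrix.mul_assoc _ _ !![-s', y * _; _, -s], e2]
      simp

section PowersModIrreducible

variable {F : Type*} [Field F] [Fintype F]

/-- The sum `1 + q + ⋯ + q ^ (n k - 1)` is divisible by `q ^ n - 1` when `q - 1 ∣ k`. -/
lemma pow_sub_one_dvd_geom_sum {q : ℤ} {n k : ℕ} (hq : q ≠ 1) (hk : q - 1 ∣ (k : ℤ)) :
    q ^ n - 1 ∣ ∑ i ∈ Finset.range (n * k), q ^ i := by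
  have h : q - 1 ∣ ∑ j ∈ Finset.range k, (q ^ n) ^ j := by
    have h1 : q - 1 ∣ ∑ j ∈ Finset.range k, ((q ^ n) ^ j - 1) :=
      Finset.dvd_sum fun j _ => by
        rw [← pow_mul]
        exact sub_one_dvd_pow_sub_one q _
    rw [Finset.sum_sub_distrib] at h1
    simpa using dvd_add h1 (by simpa using hk : q - 1 ∣ ∑ j ∈ Finset.range k, (1 : ℤ))
  obtain ⟨c, hc⟩ := h
  refine ⟨c, mul_right_cancel₀ (sub_ne_zero.mpr hq) ?_⟩
  rw [geom_sum_mul, pow_mul, ← geom_sum_mul, hc]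
  ring

lemma card_adjoinRoot {P : F[X]} (hP : P ≠ 0) :
    Nat.card (AdjoinRoot P) = Fintype.card F ^ P.natDegree := by
  have := (AdjoinRoot.powerBasis hP).finite
  rw [Module.natCard_eq_pow_finrank (K := F), (AdjoinRoot.powerBasis hP).finrank,
    AdjoinRoot.powerBasis_dim, Nat.card_eq_fintype_card]

/-- In the residue field of an irreducible `P`, nonzero elements have order dividing
`q ^ deg P - 1`. -/
lemma dvd_pow_card_sub_one_sub_one {P x : F[X]} (hP : Irreducible P) (hx : ¬ P ∣ x) :
    P ∣ x ^ (Fintype.card F ^ P.natDegree - 1) - 1 := by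
  have : Fact (Irreducible P) := ⟨hP⟩
  have := (AdjoinRoot.powerBasis hP.ne_zero).finite
  have : Finite (AdjoinRoot P) := Module.finite_of_finite F
  have := Fintype.ofFinite (AdjoinRoot P)
  rw [← AdjoinRoot.mk_eq_mk, map_pow, map_one, ← card_adjoinRoot hP.ne_zero,
    Nat.card_eq_fintype_card]
  exact FiniteField.pow_card_sub_one_eq_one _ (by rwa [Ne, AdjoinRoot.mk_eq_zero])

lemma dvd_pow_geom_sum_sub_self {P x : F[X]} (hP : Irreducible P) (hx : ¬ P ∣ x) {k : ℕ}
    (hk : P.natDegree * (Fintype.card F - 1) ∣ k) :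
    P ∣ x ^ (∑ i ∈ Finset.range (k + 1), Fintype.card F ^ i) - x := by
  obtain ⟨t, rfl⟩ := hk
  have hq : 1 < Fintype.card F := Fintype.one_lt_card
  have h := pow_sub_one_dvd_geom_sum (q := Fintype.card F) (n := P.natDegree)
    (k := (Fintype.card F - 1) * t) (by exact_mod_cast hq.ne')
    ⟨t, by push_cast [Nat.cast_sub hq.le]; rfl⟩
  have hnat : Fintype.card F ^ P.natDegree - 1 ∣
      ∑ i ∈ Finset.range (P.natDegree * ((Fintype.card F - 1) * t)), Fintype.card F ^ i := by
    rw [← Int.natCast_dvd_natCast]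
    push_cast [Nat.cast_sub (Nat.one_le_pow _ _ hq.le)]
    exact h
  obtain ⟨c, hc⟩ := hnat
  rw [mul_assoc, geom_sum_succ, hc, pow_succ,
    show ∀ a : F[X], a * x - x = (a - 1) * x from fun a => by ring, mul_left_comm, pow_mul]
  exact ((dvd_pow_card_sub_one_sub_one hP hx).trans (sub_one_dvd_pow_sub_one _ _)).mul_right _

lemma exists_dvd_pow_geom_sum_sub_C {P x : F[X]} (hP : Irreducible P) (hx : ¬ P ∣ x) :
    ∃ z : F, z ≠ 0 ∧
      P ∣ x ^ (∑ i ∈ Finset.range P.natDegree, Fintype.card F ^ i) - C z := by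
  have : Fact (Irreducible P) := ⟨hP⟩
  have hq : 1 < Fintype.card F := Fintype.one_lt_card
  set m := ∑ i ∈ Finset.range P.natDegree, Fintype.card F ^ i with hm
  have hm' : m * (Fintype.card F - 1) = Fintype.card F ^ P.natDegree - 1 := by
    have := geom_sum_mul_add (Fintype.card F - 1) P.natDegree
    rw [Nat.sub_add_cancel hq.le, ← hm] at this
    omega
  have h1 : AdjoinRoot.mk P (x ^ m) ^ (Fintype.card F - 1) = 1 := by
    rw [← map_pow, ← pow_mul, hm', ← map_one (AdjoinRoot.mk P), AdjoinRoot.mk_eq_mk]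
    exact dvd_pow_card_sub_one_sub_one hP hx
  have hroot : ((X ^ Nat.card F - X : F[X]).map (AdjoinRoot.of P)).IsRoot
      (AdjoinRoot.mk P (x ^ m)) := by
    have hq' : Fintype.card F = Fintype.card F - 1 + 1 := (Nat.sub_add_cancel hq.le).symm
    rw [Nat.card_eq_fintype_card, hq', IsRoot.def]
    simp [pow_succ, h1, -map_pow]
  obtain ⟨z, hz⟩ := splits_X_pow_nat_card_sub_X.mem_range_of_isRoot
    (by rw [Nat.card_eq_fintype_card]; exact FiniteField.X_pow_card_sub_X_ne_zero F hq) hroot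
  refine ⟨z, ?_, ?_⟩
  · rintro rfl
    rw [map_zero, eq_comm, AdjoinRoot.mk_eq_zero] at hz
    exact hx (hP.prime.dvd_of_dvd_pow hz)
  · rw [← AdjoinRoot.mk_eq_mk, ← hz, AdjoinRoot.mk_C]

end PowersModIrreducible

open scoped ComplexOrder PowerSeries in
/-- If a polynomial with constant term `1` has a logarithmic derivative with nonnegative
coefficients, then these coefficients vanish in large degrees. -/
lemma logDeriv_coeff_eq_zero {R : ℂ[X]} (hR : R.coeff 0 = 1) {r : ℕ → ℂ} (hr : ∀ n, 0 ≤ r n)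
    (h : PowerSeries.mk r * (R : ℂ⟦X⟧) = ((X * derivative R : ℂ[X]) : ℂ⟦X⟧)) {n : ℕ}
    (hn : R.natDegree < n) : r n = 0 := by
  have key : ∀ n : ℕ, (n : ℂ) * R.coeff n =
      ∑ p ∈ Finset.HasAntidiagonal.antidiagonal n, r p.1 * R.coeff p.2 := by
    intro n
    have := congrArg (PowerSeries.coeff n) h
    rw [PowerSeries.coeff_mul, Polynomial.coeff_coe] at this
    simp only [PowerSeries.coeff_mk, Polynomial.coeff_coe] at this
    rw [this]
    cases n with
    | zero => simp
    | succ n => rw [coeff_X_mul, coeff_derivative, mul_comm]; push_cast; ring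
  have h0 : r 0 = 0 := by simpa [hR] using (key 0).symm
  have hpos : ∀ n, 0 ≤ R.coeff n := by
    intro n
    induction n using Nat.strong_induction_on with
    | _ n ih =>
      rcases Nat.eq_zero_or_pos n with rfl | hn0
      · rw [hR]; exact zero_le_one
      · have h1 : 0 ≤ (n : ℂ) * R.coeff n := by
          rw [key]
          refine Finset.sum_nonneg fun p hp => ?_
          rw [Finset.HasAntidiagonal.mem_antidiagonal] at hp
          rcases Nat.eq_zero_or_pos p.1 with hp1 | hp1
          · rw [hp1, h0, zero_mul]
          · exact mul_nonneg (hr _) (ih _ (by omega))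
        have h2 : R.coeff n = ((n : ℝ)⁻¹ : ℝ) * ((n : ℂ) * R.coeff n) := by
          have : (n : ℂ) ≠ 0 := by exact_mod_cast hn0.ne'
          push_cast
          field_simp
        rw [h2]
        exact mul_nonneg (by rw [Complex.zero_le_real]; positivity) h1
  have h1 : r n * R.coeff 0 ≤ ∑ p ∈ Finset.HasAntidiagonal.antidiagonal n, r p.1 * R.coeff p.2 :=
    Finset.single_le_sum (f := fun p : ℕ × ℕ => r p.1 * R.coeff p.2)
      (fun p _ => mul_nonneg (hr _) (hpos _))
      (show (n, 0) ∈ Finset.HasAntidiagonal.antidiagonal n by simp)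
  rw [← key, coeff_eq_zero_of_natDegree_lt hn, hR, mul_one, mul_zero] at h1
  exact le_antisymm h1 (hr n)

open scoped PowerSeries in
lemma logDeriv_finset_prod {ι : Type*} (s : Finset ι) (L : ι → ℂ[X]) (c : ι → ℂ⟦X⟧) (ε : ℂ)
    (h : ∀ i ∈ s, c i * (L i : ℂ⟦X⟧) = ((C ε * (X * derivative (L i)) : ℂ[X]) : ℂ⟦X⟧)) :
    (∑ i ∈ s, c i) * ((∏ i ∈ s, L i : ℂ[X]) : ℂ⟦X⟧) =
      ((C ε * (X * derivative (∏ i ∈ s, L i)) : ℂ[X]) : ℂ⟦X⟧) := by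
  classical
  induction s using Finset.induction_on with
  | empty => simp
  | insert a s ha ih =>
    have h1 := h a (Finset.mem_insert_self a s)
    have h2 := ih fun i hi => h i (Finset.mem_insert_of_mem hi)
    rw [Finset.sum_insert ha, Finset.prod_insert ha, derivative_mul]
    simp only [Polynomial.coe_mul, Polynomial.coe_add] at h1 h2 ⊢
    linear_combination ((∏ i ∈ s, L i : ℂ[X]) : ℂ⟦X⟧) * h1 + (L a : ℂ⟦X⟧) * h2

open scoped ComplexOrder PowerSeries in
/-- A family of non-principal polynomials `L i` (`i ∉ T`) cannot have a common product divisible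
by that of the principal factors `1 - q ω X`, if the total logarithmic derivative has
nonnegative coefficients which do not eventually vanish. -/
lemma exists_eval_ne_zero {ι : Type*} (S T : Finset ι) (L : ι → ℂ[X]) (c : ι → ℕ → ℂ)
    (w : ι → ℂ) (hw : ∀ t ∈ T, w t ≠ 0) (hinj : Set.InjOn w T)
    (hT : ∀ t ∈ T, L t = 1 - C (w t) * X) (hS : ∀ i ∈ S, (L i).coeff 0 = 1)
    (hcT : ∀ i ∈ T, PowerSeries.mk (c i) * (L i : ℂ⟦X⟧) =
      ((C (-1) * (X * derivative (L i)) : ℂ[X]) : ℂ⟦X⟧))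
    (hcS : ∀ i ∈ S, PowerSeries.mk (c i) * (L i : ℂ⟦X⟧) =
      ((C 1 * (X * derivative (L i)) : ℂ[X]) : ℂ⟦X⟧))
    (hr : ∀ n, 0 ≤ ∑ i ∈ S, c i n + ∑ i ∈ T, c i n)
    (hinf : ∀ m, ∃ n, m < n ∧ ∑ i ∈ S, c i n + ∑ i ∈ T, c i n ≠ 0) :
    ∃ t ∈ T, ∀ i ∈ S, (L i).eval (w t)⁻¹ ≠ 0 := by
  by_contra! hcon
  have hdvd : ∏ t ∈ T, L t ∣ ∏ i ∈ S, L i := by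
    refine Finset.prod_dvd_of_coprime ?_ ?_
    · intro t ht t' ht' hne
      have hne' : w t - w t' ≠ 0 := sub_ne_zero.2 fun h => hne (hinj ht ht' h)
      refine ⟨C (-(w t') / (w t - w t')), C (w t / (w t - w t')), ?_⟩
      rw [hT t ht, hT t' ht']
      have h1 : C (-(w t') / (w t - w t')) * C (w t) + C (w t / (w t - w t')) * C (w t') = 0 := by
        rw [← C_mul, ← C_mul, ← C_add, ← C_0]; congr 1; ring
      have h2 : C (-(w t') / (w t - w t')) + C (w t / (w t - w t')) = 1 := by
        rw [← C_add, ← C_1]; congr 1; field_simp; ring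
      linear_combination h2 - X * h1
    · intro t ht
      obtain ⟨i, hi, h0⟩ := hcon t ht
      refine dvd_trans ?_ (Finset.dvd_prod_of_mem L hi)
      have h1 : X - C (w t)⁻¹ ∣ L i := dvd_iff_isRoot.2 h0
      have h2 : L t = C (-(w t)) * (X - C (w t)⁻¹) := by
        rw [hT t ht, mul_sub, ← C_mul, neg_mul, mul_inv_cancel₀ (hw t ht)]; simp; ring
      rw [h2]
      exact (IsUnit.mul_left_dvd (isUnit_C.2 (neg_ne_zero.2 (hw t ht)).isUnit)).2 h1
  obtain ⟨R, hR⟩ := hdvd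
  have hZ1 : (∏ t ∈ T, L t).coeff 0 = 1 := by
    rw [coeff_zero_eq_eval_zero, eval_prod]
    exact Finset.prod_eq_one fun t ht => by simp [hT t ht]
  have hZ0 : ((∏ t ∈ T, L t : ℂ[X]) : ℂ⟦X⟧) ≠ 0 := by
    rw [Ne, Polynomial.coe_eq_zero_iff]
    intro h
    simp [h] at hZ1
  have hR1 : R.coeff 0 = 1 := by
    have h1 : (∏ i ∈ S, L i).coeff 0 = 1 := by
      rw [coeff_zero_eq_eval_zero, eval_prod]
      exact Finset.prod_eq_one fun i hi => by rw [← coeff_zero_eq_eval_zero, hS i hi]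
    rwa [hR, mul_coeff_zero, hZ1, one_mul] at h1
  have hlog : PowerSeries.mk (fun n => ∑ i ∈ S, c i n + ∑ i ∈ T, c i n) * (R : ℂ⟦X⟧) =
      ((X * derivative R : ℂ[X]) : ℂ⟦X⟧) := by
    have hsum : PowerSeries.mk (fun n => ∑ i ∈ S, c i n + ∑ i ∈ T, c i n) =
        ∑ i ∈ S, PowerSeries.mk (c i) + ∑ i ∈ T, PowerSeries.mk (c i) := by
      ext n; simp
    have h1 := logDeriv_finset_prod S L _ 1 hcS
    have h2 := logDeriv_finset_prod T L _ (-1) hcT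
    rw [hR, derivative_mul] at h1
    refine mul_left_cancel₀ hZ0 ?_
    rw [hsum]
    simp only [Polynomial.coe_mul, Polynomial.coe_add, Polynomial.coe_C] at h1 h2 ⊢
    rw [map_one] at h1
    rw [map_neg, map_one] at h2
    linear_combination h1 + (R : ℂ⟦X⟧) * h2
  obtain ⟨n, hn, hne⟩ := hinf R.natDegree
  exact hne (logDeriv_coeff_eq_zero hR1 hr hlog hn)

open scoped PowerSeries in
lemma eval_eq_zero_of_mul_eq {W E : ℂ[X]} {D : ℕ → ℂ} {z : ℂ}
    (hD : Summable fun n => ‖D n * z ^ n‖) (h : PowerSeries.mk D * (W : ℂ⟦X⟧) = (E : ℂ⟦X⟧))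
    (hW : W.eval z = 0) : E.eval z = 0 := by
  have hsum : ∀ P : ℂ[X], HasSum (fun n => P.coeff n * z ^ n) (P.eval z) := fun P => by
    rw [eval_eq_sum_range]
    refine hasSum_sum_of_ne_finset_zero fun n hn => ?_
    rw [Finset.mem_range, Nat.lt_succ_iff, not_le] at hn
    rw [coeff_eq_zero_of_natDegree_lt hn, zero_mul]
  have hWs : Summable fun n => ‖W.coeff n * z ^ n‖ := by
    refine summable_of_ne_finset_zero (s := Finset.range (W.natDegree + 1)) fun n hn => ?_
    rw [Finset.mem_range, Nat.lt_succ_iff, not_le] at hn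
    rw [coeff_eq_zero_of_natDegree_lt hn, zero_mul, norm_zero]
  have h1 := tsum_mul_tsum_eq_tsum_sum_antidiagonal_of_summable_norm hD hWs
  rw [(hsum W).tsum_eq, hW, mul_zero] at h1
  rw [← (hsum E).tsum_eq, h1]
  refine tsum_congr fun n => ?_
  have h2 := congrArg (PowerSeries.coeff n) h
  rw [PowerSeries.coeff_mul, Polynomial.coeff_coe] at h2
  rw [← h2, Finset.sum_mul]
  refine Finset.sum_congr rfl fun p hp => ?_
  rw [← Finset.HasAntidiagonal.mem_antidiagonal.1 hp, pow_add, PowerSeries.coeff_mk,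
    Polynomial.coeff_coe]
  ring

open scoped PowerSeries in
/-- A linear combination of logarithmic derivatives of polynomials, one of which has a zero at `z`,
does not converge absolutely at `z`. -/
lemma not_summable_logDeriv {ι : Type*} [Fintype ι] [DecidableEq ι] (i₀ : ι) (L : ι → ℂ[X])
    (c : ι → ℕ → ℂ) (ε u : ι → ℂ) {z : ℂ} (hz : z ≠ 0)
    (hc : ∀ i, PowerSeries.mk (c i) * (L i : ℂ⟦X⟧) =
      ((C (ε i) * (X * derivative (L i)) : ℂ[X]) : ℂ⟦X⟧))
    (h₀ : (L i₀).eval z = 0) (h₀' : (derivative (L i₀)).eval z ≠ 0)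
    (hε : ε i₀ ≠ 0) (hu : u i₀ ≠ 0) (hL : ∀ i, i ≠ i₀ → (L i).eval z ≠ 0) :
    ¬ Summable fun n => ‖(∑ i, u i * c i n) * z ^ n‖ := by
  intro hD
  have h := eval_eq_zero_of_mul_eq (W := ∏ i, L i) (E := ∑ i, C (u i) * (C (ε i) *
    (X * derivative (L i))) * ∏ j ∈ Finset.univ.erase i, L j) hD ?_ ?_
  · rw [eval_finsetSum, Finset.sum_eq_single i₀] at h
    · simp only [eval_mul, eval_C, eval_X, eval_prod, mul_eq_zero, hu, hε, hz, h₀', false_or,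
        Finset.prod_eq_zero_iff] at h
      obtain ⟨j, hj, hj0⟩ := h
      exact hL j (Finset.ne_of_mem_erase hj) hj0
    · intro i _ hi
      rw [eval_mul, eval_prod, Finset.prod_eq_zero (i := i₀) (by simp [hi.symm]) h₀, mul_zero]
    · simp
  · have hsum : PowerSeries.mk (fun n => ∑ i, u i * c i n) =
        ∑ i, PowerSeries.C (u i) * PowerSeries.mk (c i) := by
      ext n; simp
    have hcoe : ∀ f : ι → ℂ[X], ((∑ i, f i : ℂ[X]) : ℂ⟦X⟧) = ∑ i, (f i : ℂ⟦X⟧) := fun f =>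
      map_sum (Polynomial.coeToPowerSeries.ringHom (R := ℂ)) f _
    rw [hsum, hcoe, Finset.sum_mul]
    refine Finset.sum_congr rfl fun i _ => ?_
    rw [← Finset.mul_prod_erase Finset.univ L (Finset.mem_univ i)]
    simp only [Polynomial.coe_mul, Polynomial.coe_C] at hc ⊢
    linear_combination PowerSeries.C (u i) * ((∏ j ∈ Finset.univ.erase i, L j : ℂ[X]) : ℂ⟦X⟧) * hc i
  · rw [eval_prod]
    exact Finset.prod_eq_zero (Finset.mem_univ i₀) h₀

open UniqueFactorizationMonoid in
lemma mem_normalizedFactors_iff_count {F : Type*} [Field F] [DecidableEq F] {f P : F[X]}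
    (hf : f ≠ 0) {k : ℕ} :
    P ∈ (normalizedFactors f).toFinset ∧ k ∈ Finset.Icc 1 ((normalizedFactors f).count P) ↔
      P.Monic ∧ Irreducible P ∧ 0 < k ∧ P ^ k ∣ f := by
  have key : P.Monic → Irreducible P → (k ≤ (normalizedFactors f).count P ↔ P ^ k ∣ f) := by
    intro h1 h2
    rw [pow_dvd_iff_le_emultiplicity, emultiplicity_eq_count_normalizedFactors h2 hf,
      h1.normalize_eq_self]
    norm_cast
  rw [Multiset.mem_toFinset, Finset.mem_Icc]
  constructor
  · rintro ⟨h1, h2, h3⟩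
    have hm : P.Monic := by
      rw [← normalize_normalized_factor P h1]
      exact monic_normalize (ne_zero_of_mem_normalizedFactors h1)
    have hi := irreducible_of_normalized_factor P h1
    exact ⟨hm, hi, h2, (key hm hi).1 h3⟩
  · rintro ⟨hm, hi, h2, h3⟩
    have h4 := (key hm hi).2 h3
    exact ⟨Multiset.count_pos.1 (by omega), h2, h4⟩

open UniqueFactorizationMonoid in
lemma natDegree_eq_sum_count {F : Type*} [Field F] [DecidableEq F] {f : F[X]} (hf : f.Monic) :
    f.natDegree = ∑ P ∈ (normalizedFactors f).toFinset,
      ∑ _k ∈ Finset.Icc 1 ((normalizedFactors f).count P), P.natDegree := by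
  have h := leadingCoeff_mul_prod_normalizedFactors f
  rw [hf.leadingCoeff, C_1, one_mul] at h
  conv_lhs => rw [← h]
  rw [natDegree_multiset_prod _ (zero_notMem_normalizedFactors f),
    Finset.sum_multiset_map_count]
  simp

section Counting

variable {F : Type*} [Field F] [Fintype F]

lemma finite_natDegree_le (n : ℕ) : {f : F[X] | f.natDegree ≤ n}.Finite := by
  have : Finite (degreeLT F (n + 1)) := (degreeLTEquiv F (n + 1)).toEquiv.finite_iff.2 inferInstance
  refine (Set.toFinite (degreeLT F (n + 1) : Set F[X])).subset fun f hf => ?_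
  rw [SetLike.mem_coe, mem_degreeLT]
  exact degree_le_natDegree.trans_lt (by exact_mod_cast Nat.lt_succ_of_le hf)

lemma finite_monic_natDegree_eq (n : ℕ) : {f : F[X] | f.Monic ∧ f.natDegree = n}.Finite :=
  (finite_natDegree_le n).subset fun _ hf => hf.2.le

variable (F) in
/-- The monic polynomials of degree `n` over a finite field. -/
noncomputable def monicsOfDegree (n : ℕ) : Finset F[X] := (finite_monic_natDegree_eq n).toFinset

lemma mem_monicsOfDegree {n : ℕ} {f : F[X]} :
    f ∈ monicsOfDegree F n ↔ f.Monic ∧ f.natDegree = n := by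
  simp [monicsOfDegree]

lemma card_monicsOfDegree (n : ℕ) : (monicsOfDegree F n).card = Fintype.card F ^ n := by
  rw [monicsOfDegree, ← Nat.card_eq_card_finite_toFinset]
  refine (Nat.card_congr ((monicEquivDegreeLT n).trans (degreeLTEquiv F n).toEquiv)).trans ?_
  simp

lemma finite_primePowers (n : ℕ) : {p : F[X] × ℕ | p.1.Monic ∧ Irreducible p.1 ∧ 0 < p.2 ∧
    p.2 * p.1.natDegree = n}.Finite := by
  refine ((finite_natDegree_le n).prod (Set.finite_Iic n)).subset ?_
  rintro ⟨P, k⟩ ⟨-, hP, hk, h⟩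
  exact ⟨(Nat.le_mul_of_pos_left _ hk).trans h.le,
    (Nat.le_mul_of_pos_right _ hP.natDegree_pos).trans h.le⟩

variable (F) in
/-- The pairs `(P, k)` with `P` monic irreducible, `k` positive and `P ^ k` of degree `n`. -/
noncomputable def primePowersOfDegree (n : ℕ) : Finset (F[X] × ℕ) := (finite_primePowers n).toFinset

lemma mem_primePowersOfDegree {n : ℕ} {p : F[X] × ℕ} : p ∈ primePowersOfDegree F n ↔
    p.1.Monic ∧ Irreducible p.1 ∧ 0 < p.2 ∧ p.2 * p.1.natDegree = n := by
  simp [primePowersOfDegree]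

/-- The coefficients of the `L`-series of a function on monic polynomials. -/
noncomputable def lCoeff (ψ : F[X] → ℂ) (n : ℕ) : ℂ := ∑ f ∈ monicsOfDegree F n, ψ f

/-- The coefficients of the logarithmic derivative of the `L`-series of a multiplicative function
on monic polynomials. -/
noncomputable def vonMangoldtCoeff (ψ : F[X] → ℂ) (n : ℕ) : ℂ :=
  ∑ p ∈ primePowersOfDegree F n, (p.1.natDegree : ℂ) * ψ (p.1 ^ p.2)

theorem natCast_mul_lCoeff {ψ : F[X] → ℂ} (hψ : ∀ f g, f.Monic → g.Monic → ψ (f * g) = ψ f * ψ g)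
    (n : ℕ) : (n : ℂ) * lCoeff ψ n = ∑ p ∈ Finset.HasAntidiagonal.antidiagonal n,
      vonMangoldtCoeff ψ p.1 * lCoeff ψ p.2 := by
  classical
  have h1 : (n : ℂ) * lCoeff ψ n = ∑ f ∈ monicsOfDegree F n,
      ∑ p ∈ (UniqueFactorizationMonoid.normalizedFactors f).toFinset.sigma fun P =>
        Finset.Icc 1 ((UniqueFactorizationMonoid.normalizedFactors f).count P),
        (p.1.natDegree : ℂ) * ψ f := by
    rw [lCoeff, Finset.mul_sum]
    refine Finset.sum_congr rfl fun f hf => ?_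
    rw [mem_monicsOfDegree] at hf
    rw [← Finset.sum_mul, Finset.sum_sigma, ← hf.2]
    conv_lhs => rw [natDegree_eq_sum_count hf.1]
    push_cast
    rfl
  have h2 : ∀ p ∈ Finset.HasAntidiagonal.antidiagonal n,
      vonMangoldtCoeff ψ p.1 * lCoeff ψ p.2 = ∑ a ∈ primePowersOfDegree F p.1 ×ˢ
        monicsOfDegree F p.2, (a.1.1.natDegree : ℂ) * ψ (a.1.1 ^ a.1.2 * a.2) := by
    intro p _
    rw [vonMangoldtCoeff, lCoeff, Finset.sum_mul_sum, ← Finset.sum_product']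
    refine Finset.sum_congr rfl fun a ha => ?_
    rw [Finset.mem_product, mem_primePowersOfDegree, mem_monicsOfDegree] at ha
    rw [hψ _ _ (ha.1.1.pow _) ha.2.1, mul_assoc]
  rw [h1, Finset.sum_congr rfl h2, Finset.sum_sigma', Finset.sum_sigma']
  symm
  refine Finset.sum_bij (fun a _ => ⟨a.2.1.1 ^ a.2.1.2 * a.2.2, ⟨a.2.1.1, a.2.1.2⟩⟩) ?_ ?_ ?_ ?_
  · rintro ⟨⟨i, j⟩, ⟨⟨P, k⟩, g⟩⟩ h
    simp only [Finset.mem_sigma, Finset.mem_product, mem_primePowersOfDegree, mem_monicsOfDegree,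
      Finset.HasAntidiagonal.mem_antidiagonal] at h
    obtain ⟨hij, ⟨hm, hi, hk, hd⟩, hg, hdg⟩ := h
    have hm' := (hm.pow k).mul hg
    rw [Finset.mem_sigma, Finset.mem_sigma, mem_normalizedFactors_iff_count hm'.ne_zero,
      mem_monicsOfDegree]
    refine ⟨⟨hm', ?_⟩, hm, hi, hk, dvd_mul_right _ _⟩
    rw [(hm.pow k).natDegree_mul hg, hm.natDegree_pow, hd, hdg, hij]
  · rintro ⟨⟨i, j⟩, ⟨⟨P, k⟩, g⟩⟩ h ⟨⟨i', j'⟩, ⟨⟨P', k'⟩, g'⟩⟩ h' heq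
    simp only [Finset.mem_sigma, Finset.mem_product, mem_primePowersOfDegree, mem_monicsOfDegree,
      Finset.HasAntidiagonal.mem_antidiagonal] at h h'
    obtain ⟨hij, ⟨hm, hi, hk, hd⟩, hg, hdg⟩ := h
    obtain ⟨hij', ⟨hm', hi', hk', hd'⟩, hg', hdg'⟩ := h'
    simp only [Sigma.mk.injEq, heq_eq_eq] at heq
    obtain ⟨h1, rfl, rfl⟩ := heq
    have := mul_left_cancel₀ (hm.pow k).ne_zero h1
    subst this
    subst hd hd' hdg hdg'
    rfl
  · rintro ⟨f, ⟨P, k⟩⟩ h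
    rw [Finset.mem_sigma, Finset.mem_sigma, mem_monicsOfDegree] at h
    obtain ⟨⟨hf, hfd⟩, h⟩ := h
    dsimp only at hf hfd h
    rw [mem_normalizedFactors_iff_count hf.ne_zero] at h
    obtain ⟨hm, hi, hk, g, rfl⟩ := h
    have hg : g.Monic := (hm.pow k).of_mul_monic_left hf
    refine ⟨⟨(k * P.natDegree, g.natDegree), ((P, k), g)⟩, ?_, rfl⟩
    simp only [Finset.mem_sigma, Finset.mem_product, mem_primePowersOfDegree, mem_monicsOfDegree,
      Finset.HasAntidiagonal.mem_antidiagonal]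
    refine ⟨?_, ⟨hm, hi, hk, trivial⟩, hg, trivial⟩
    rw [← hfd, (hm.pow k).natDegree_mul hg, hm.natDegree_pow]
  · rintro ⟨⟨i, j⟩, ⟨⟨P, k⟩, g⟩⟩ h
    rfl

end Counting

section Characters

open scoped PowerSeries

lemma coe_X_mul_derivative (f : ℂ[X]) :
    ((X * derivative f : ℂ[X]) : ℂ⟦X⟧) = PowerSeries.X * PowerSeries.derivative ℂ (f : ℂ⟦X⟧) := by
  rw [Polynomial.coe_mul, Polynomial.coe_X, PowerSeries.derivative_coe]

variable {F : Type*} [Field F]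

open Classical in
/-- The product of a Dirichlet character modulo `x` (the principal one being replaced by the
constant `1`) and the character `f ↦ z ^ deg f`. -/
noncomputable def twistedChar (x : F[X]) (χ : MulChar (AdjoinRoot x) ℂ) (z : ℂ) (f : F[X]) : ℂ :=
  z ^ f.natDegree * if χ = 1 then 1 else χ (AdjoinRoot.mk x f)

lemma twistedChar_mul (x : F[X]) (χ : MulChar (AdjoinRoot x) ℂ) (z : ℂ) {f g : F[X]}
    (hf : f.Monic) (hg : g.Monic) :
    twistedChar x χ z (f * g) = twistedChar x χ z f * twistedChar x χ z g := by
  rw [twistedChar, twistedChar, twistedChar, hf.natDegree_mul hg, pow_add, map_mul, map_mul]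
  split_ifs <;> ring

variable [Fintype F]

theorem mk_vonMangoldtCoeff_mul {ψ : F[X] → ℂ}
    (hψ : ∀ f g, f.Monic → g.Monic → ψ (f * g) = ψ f * ψ g) :
    PowerSeries.mk (vonMangoldtCoeff ψ) * PowerSeries.mk (lCoeff ψ) =
      PowerSeries.X * PowerSeries.derivative ℂ (PowerSeries.mk (lCoeff ψ)) := by
  ext n
  rw [PowerSeries.coeff_mul]
  simp only [PowerSeries.coeff_mk]
  rw [← natCast_mul_lCoeff hψ]
  cases n with
  | zero => simp
  | succ n =>
    rw [PowerSeries.coeff_succ_X_mul, PowerSeries.coeff_derivative, PowerSeries.coeff_mk]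
    push_cast
    ring

lemma lCoeff_twistedChar_zero (x : F[X]) (χ : MulChar (AdjoinRoot x) ℂ) (z : ℂ) :
    lCoeff (twistedChar x χ z) 0 = 1 := by
  have h : monicsOfDegree F 0 = {1} := by
    ext f
    rw [mem_monicsOfDegree, Finset.mem_singleton]
    constructor
    · rintro ⟨h1, h2⟩
      exact h1.natDegree_eq_zero.1 h2
    · rintro rfl
      exact ⟨monic_one, natDegree_one⟩
  rw [lCoeff, h, Finset.sum_singleton, twistedChar]
  simp

lemma lCoeff_twistedChar_one (x : F[X]) (z : ℂ) (n : ℕ) :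
    lCoeff (twistedChar x 1 z) n = (Fintype.card F * z) ^ n := by
  rw [lCoeff, Finset.sum_congr rfl (g := fun _ => z ^ n)]
  · rw [Finset.sum_const, card_monicsOfDegree, nsmul_eq_mul, mul_pow]
    push_cast
    rfl
  · intro f hf
    rw [mem_monicsOfDegree] at hf
    simp [twistedChar, hf.2]

lemma lCoeff_twistedChar_of_le {x : F[X]} [Finite (AdjoinRoot x)] (hx : x ≠ 0)
    {χ : MulChar (AdjoinRoot x) ℂ} (hχ : χ ≠ 1) (z : ℂ) {n : ℕ} (hn : x.natDegree ≤ n) :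
    lCoeff (twistedChar x χ z) n = 0 := by
  have := Fintype.ofFinite (AdjoinRoot x)
  have h1 : lCoeff (twistedChar x χ z) n =
      z ^ n * ∑ f ∈ monicsOfDegree F n, χ (AdjoinRoot.mk x f) := by
    rw [lCoeff, Finset.mul_sum]
    refine Finset.sum_congr rfl fun f hf => ?_
    rw [twistedChar, if_neg hχ, (mem_monicsOfDegree.1 hf).2]
  have h2 : ∀ r : AdjoinRoot x, ∑ f ∈ monicsOfDegree F n, χ (AdjoinRoot.mk x f) =
      ∑ f ∈ monicsOfDegree F n, χ (AdjoinRoot.mk x f + r) := by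
    intro r
    obtain ⟨g, rfl⟩ := AdjoinRoot.mk_surjective r
    have hmod : AdjoinRoot.mk x (g % x) = AdjoinRoot.mk x g := by
      rw [AdjoinRoot.mk_eq_mk]
      exact ⟨-(g / x), by linear_combination EuclideanDomain.mod_add_div g x⟩
    have hdeg : ∀ f : F[X], f.natDegree = n → f.Monic → (g % x).degree < f.degree := by
      intro f hf hm
      refine (degree_mod_lt g hx).trans_le ?_
      rw [degree_eq_natDegree hm.ne_zero, degree_eq_natDegree hx, hf]
      exact_mod_cast hn
    symm
    refine Finset.sum_nbij' (fun f => f + g % x) (fun f => f - g % x) ?_ ?_ ?_ ?_ ?_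
    · intro f hf
      rw [mem_monicsOfDegree] at hf ⊢
      have := hdeg f hf.2 hf.1
      exact ⟨hf.1.add_of_left this, by rw [natDegree_add_eq_left_of_degree_lt this, hf.2]⟩
    · intro f hf
      rw [mem_monicsOfDegree] at hf ⊢
      have := hdeg f hf.2 hf.1
      exact ⟨hf.1.sub_of_left this, by
        rw [natDegree_eq_of_degree_eq (degree_sub_eq_left_of_degree_lt this), hf.2]⟩
    · intro f _; ring
    · intro f _; ring
    · intro f _
      rw [map_add (AdjoinRoot.mk x), hmod]
  have h3 : (Fintype.card (AdjoinRoot x) : ℂ) * ∑ f ∈ monicsOfDegree F n, χ (AdjoinRoot.mk x f)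
      = 0 := by
    rw [← nsmul_eq_mul, ← Finset.card_univ, ← Finset.sum_const,
      Finset.sum_congr rfl fun r _ => h2 r, Finset.sum_comm]
    refine Finset.sum_eq_zero fun f _ => ?_
    rw [← MulChar.sum_eq_zero_of_ne_one hχ]
    exact Fintype.sum_equiv (Equiv.addLeft (AdjoinRoot.mk x f)) _ _ fun r => rfl
  have h4 : (Fintype.card (AdjoinRoot x) : ℂ) ≠ 0 := by
    exact_mod_cast Fintype.card_ne_zero
  rw [h1, (mul_eq_zero.1 h3).resolve_left h4, mul_zero]

open Classical in
/-- The `L`-polynomial of `twistedChar x χ z`, or its inverse `1 - q z X` if `χ` is principal. -/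
noncomputable def twistedL (x : F[X]) (χ : MulChar (AdjoinRoot x) ℂ) (z : ℂ) : ℂ[X] :=
  if χ = 1 then 1 - C (Fintype.card F * z) * X
  else ∑ n ∈ Finset.range x.natDegree, monomial n (lCoeff (twistedChar x χ z) n)

lemma twistedL_one (x : F[X]) (z : ℂ) : twistedL x 1 z = 1 - C (Fintype.card F * z) * X :=
  if_pos rfl

lemma coe_twistedL {x : F[X]} [Finite (AdjoinRoot x)] (hx : x ≠ 0)
    {χ : MulChar (AdjoinRoot x) ℂ} (hχ : χ ≠ 1) (z : ℂ) :
    (twistedL x χ z : ℂ⟦X⟧) = PowerSeries.mk (lCoeff (twistedChar x χ z)) := by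
  ext n
  rw [Polynomial.coeff_coe, PowerSeries.coeff_mk, twistedL, if_neg hχ, finsetSum_coeff]
  simp only [coeff_monomial, Finset.sum_ite_eq', Finset.mem_range]
  split_ifs with h
  · rfl
  · rw [lCoeff_twistedChar_of_le hx hχ z (not_lt.1 h)]

lemma mk_vonMangoldtCoeff_mul_twistedL_one (x : F[X]) (z : ℂ) :
    PowerSeries.mk (vonMangoldtCoeff (twistedChar x 1 z)) * (twistedL x 1 z : ℂ⟦X⟧) =
      ((C (-1) * (X * derivative (twistedL x 1 z)) : ℂ[X]) : ℂ⟦X⟧) := by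
  have h := mk_vonMangoldtCoeff_mul (ψ := twistedChar x 1 z) fun f g => twistedChar_mul x 1 z
  have hgeom : (twistedL x 1 z : ℂ⟦X⟧) * PowerSeries.mk (lCoeff (twistedChar x 1 z)) = 1 := by
    ext n
    rw [twistedL_one]
    simp only [Polynomial.coe_sub, Polynomial.coe_one, Polynomial.coe_mul, Polynomial.coe_C,
      Polynomial.coe_X, sub_mul, one_mul, mul_assoc, map_sub]
    cases n with
    | zero => simp [lCoeff_twistedChar_zero]
    | succ n =>
      rw [PowerSeries.coeff_C_mul, PowerSeries.coeff_succ_X_mul, PowerSeries.coeff_mk,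
        PowerSeries.coeff_mk, lCoeff_twistedChar_one, lCoeff_twistedChar_one,
        PowerSeries.coeff_one, if_neg n.succ_ne_zero]
      ring
  have hd := congrArg (PowerSeries.derivative ℂ) hgeom
  rw [Derivation.leibniz, smul_eq_mul, smul_eq_mul, PowerSeries.derivative_one] at hd
  rw [Polynomial.coe_mul, coe_X_mul_derivative, Polynomial.coe_C, map_neg, map_one]
  generalize (twistedL x 1 z : ℂ⟦X⟧) = l at *
  generalize PowerSeries.mk (lCoeff (twistedChar x 1 z)) = s at *
  linear_combination (-PowerSeries.mk (vonMangoldtCoeff (twistedChar x 1 z)) * l -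
    PowerSeries.X * PowerSeries.derivative ℂ l) * hgeom + l * l * h + l * PowerSeries.X * hd

lemma mk_vonMangoldtCoeff_mul_twistedL {x : F[X]} [Finite (AdjoinRoot x)] (hx : x ≠ 0)
    {χ : MulChar (AdjoinRoot x) ℂ} (hχ : χ ≠ 1) (z : ℂ) :
    PowerSeries.mk (vonMangoldtCoeff (twistedChar x χ z)) * (twistedL x χ z : ℂ⟦X⟧) =
      ((C 1 * (X * derivative (twistedL x χ z)) : ℂ[X]) : ℂ⟦X⟧) := by
  rw [C_1, one_mul, coe_X_mul_derivative, coe_twistedL hx hχ]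
  exact mk_vonMangoldtCoeff_mul fun f g => twistedChar_mul x χ z

end Characters

section Orthogonality

variable {F : Type*} [Field F]

open Classical in
/-- The sum of `χ u * χ f` over all characters modulo `x`, where the principal character
has been replaced by the constant `1` in the second factor. -/
noncomputable def charSum (x : F[X]) [Fintype (MulChar (AdjoinRoot x) ℂ)] (u : AdjoinRoot x)
    (f : F[X]) : ℂ :=
  ∑ χ : MulChar (AdjoinRoot x) ℂ, χ u * if χ = 1 then 1 else χ (AdjoinRoot.mk x f)

variable {x : F[X]} [Fintype (MulChar (AdjoinRoot x) ℂ)]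

lemma charSum_eq_of_isUnit {u : AdjoinRoot x} {f : F[X]} (hf : IsUnit (AdjoinRoot.mk x f)) :
    charSum x u f = ∑ χ : MulChar (AdjoinRoot x) ℂ, χ (u * AdjoinRoot.mk x f) := by
  refine Finset.sum_congr rfl fun χ _ => ?_
  rw [map_mul]
  split_ifs with h
  · rw [h, MulChar.one_apply hf]
  · rfl

lemma charSum_eq_card {u : AdjoinRoot x} {f : F[X]} (h : u * AdjoinRoot.mk x f = 1) :
    charSum x u f = Fintype.card (MulChar (AdjoinRoot x) ℂ) := by
  rw [charSum_eq_of_isUnit (.of_mul_eq_one_right _ h), h]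
  simp

lemma charSum_eq_zero [Finite (AdjoinRoot x)] {u : AdjoinRoot x} {f : F[X]}
    (hf : IsUnit (AdjoinRoot.mk x f)) (h : u * AdjoinRoot.mk x f ≠ 1) : charSum x u f = 0 := by
  rw [charSum_eq_of_isUnit hf]
  obtain ⟨χ, hχ⟩ := MulChar.exists_apply_ne_one_of_hasEnoughRootsOfUnity (AdjoinRoot x) ℂ h
  refine eq_zero_of_mul_eq_self_left hχ ?_
  simp only [Finset.mul_sum, ← MulChar.mul_apply]
  exact Fintype.sum_bijective _ (Group.mulLeft_bijective χ) _ _ fun χ' ↦ rfl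

lemma charSum_eq_one {u : AdjoinRoot x} (hu : IsUnit u) {f : F[X]}
    (hf : ¬ IsUnit (AdjoinRoot.mk x f)) : charSum x u f = 1 := by
  rw [charSum, Finset.sum_eq_single 1]
  · rw [if_pos rfl, MulChar.one_apply hu, one_mul]
  · intro χ _ hχ
    rw [if_neg hχ, MulChar.map_nonunit χ hf, mul_zero]
  · simp

lemma charSum_eq_or [Finite (AdjoinRoot x)] {u : AdjoinRoot x} (hu : IsUnit u) (f : F[X]) :
    charSum x u f = Fintype.card (MulChar (AdjoinRoot x) ℂ) ∨ charSum x u f = 0 ∨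
      charSum x u f = 1 := by
  by_cases hf : IsUnit (AdjoinRoot.mk x f)
  · by_cases h : u * AdjoinRoot.mk x f = 1
    · exact .inl (charSum_eq_card h)
    · exact .inr (.inl (charSum_eq_zero hf h))
  · exact .inr (.inr (charSum_eq_one hu hf))

open scoped ComplexOrder in
lemma charSum_nonneg [Finite (AdjoinRoot x)] {u : AdjoinRoot x} (hu : IsUnit u) (f : F[X]) :
    0 ≤ charSum x u f := by
  rcases charSum_eq_or hu f with h | h | h <;> rw [h]
  · exact Nat.cast_nonneg _
  · exact zero_le_one

lemma norm_charSum_le [Finite (AdjoinRoot x)] {u : AdjoinRoot x} (hu : IsUnit u) (f : F[X]) :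
    ‖charSum x u f‖ ≤ Fintype.card (MulChar (AdjoinRoot x) ℂ) := by
  rcases charSum_eq_or hu f with h | h | h <;> rw [h]
  · simp
  · simp
  · rw [norm_one]
    exact_mod_cast Fintype.card_pos_iff.2 ⟨1⟩

lemma sum_pow_of_isPrimitiveRoot {ζ : ℂ} {N : ℕ} (hζ : IsPrimitiveRoot ζ N) (m : ℕ) :
    ∑ j : Fin N, (ζ ^ (j : ℕ)) ^ m = if N ∣ m then (N : ℂ) else 0 := by
  simp_rw [← pow_mul, mul_comm _ m, pow_mul]
  rw [Fin.sum_univ_eq_sum_range (fun j => (ζ ^ m) ^ j) N]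
  split_ifs with h
  · rw [(hζ.pow_eq_one_iff_dvd m).2 h]
    simp
  · have h1 : ζ ^ m - 1 ≠ 0 := sub_ne_zero.2 fun h1 => h ((hζ.pow_eq_one_iff_dvd m).1 h1)
    have h2 := geom_sum_mul (ζ ^ m) N
    have h3 : (ζ ^ m) ^ N = 1 := by rw [← pow_mul, mul_comm, pow_mul, hζ.pow_eq_one, one_pow]
    rw [h3, sub_self] at h2
    exact (mul_eq_zero.1 h2).resolve_right h1

theorem sum_vonMangoldtCoeff [Fintype F] (u : AdjoinRoot x) {ζ : ℂ} {N : ℕ}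
    (hζ : IsPrimitiveRoot ζ N) (s n : ℕ) :
    ∑ i : MulChar (AdjoinRoot x) ℂ × Fin N, i.1 u * (ζ ^ (i.2 : ℕ)) ^ s *
      vonMangoldtCoeff (twistedChar x i.1 (ζ ^ (i.2 : ℕ))) n =
    (if N ∣ n + s then (N : ℂ) else 0) *
      ∑ p ∈ primePowersOfDegree F n, (p.1.natDegree : ℂ) * charSum x u (p.1 ^ p.2) := by
  rw [← sum_pow_of_isPrimitiveRoot hζ, Finset.mul_sum]
  simp only [vonMangoldtCoeff, Finset.mul_sum]
  rw [Finset.sum_comm]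
  refine Finset.sum_congr rfl fun p hp => ?_
  have hdeg : (p.1 ^ p.2).natDegree = n := by
    rw [mem_primePowersOfDegree] at hp
    rw [hp.1.natDegree_pow, hp.2.2.2]
  rw [charSum, Finset.sum_mul, Fintype.sum_prod_type_right]
  refine Finset.sum_congr rfl fun j _ => ?_
  rw [Finset.mul_sum, Finset.mul_sum]
  refine Finset.sum_congr rfl fun χ _ => ?_
  rw [twistedChar, hdeg]
  ring

end Orthogonality

section Dirichlet

variable {F : Type*} [Field F] {x : F[X]}

open scoped ComplexOrder in
lemma exists_charSum_X_pow_pos [Finite (AdjoinRoot x)] [Fintype (MulChar (AdjoinRoot x) ℂ)]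
    {N : ℕ} (hN : 0 < N) (m : ℕ) :
    ∃ n, m < n ∧ N ∣ n ∧ 0 < charSum x 1 (X ^ n) := by
  have hc : 0 < Nat.card (AdjoinRoot x)ˣ := Nat.card_pos
  refine ⟨N * (Nat.card (AdjoinRoot x)ˣ * (m + 1)), ?_, dvd_mul_right _ _, ?_⟩
  · exact (Nat.lt_succ_self m).trans_le ((Nat.le_mul_of_pos_left _ hc).trans
      (Nat.le_mul_of_pos_left _ hN))
  by_cases h : IsUnit (AdjoinRoot.mk x (X : F[X]))
  · rw [charSum_eq_card]
    · exact_mod_cast Fintype.card_pos_iff.2 ⟨1⟩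
    · obtain ⟨v, hv⟩ := h
      rw [one_mul, map_pow, ← hv, ← Units.val_pow_eq_pow_val, mul_left_comm, pow_mul,
        pow_card_eq_one', one_pow, Units.val_one]
  · rw [charSum_eq_one isUnit_one]
    · exact zero_lt_one
    · rw [map_pow, isUnit_pow_iff (by positivity)]
      exact h

lemma isUnit_mk_of_natDegree_lt (hx : x ≠ 0) {P : F[X]} (hP : Irreducible P)
    (h : x.natDegree < P.natDegree) : IsUnit (AdjoinRoot.mk x P) := by
  have h1 : IsCoprime P x := (hP.coprime_iff_not_dvd).2 fun h2 =>
    h.not_ge (natDegree_le_of_dvd h2 hx)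
  obtain ⟨a, b, hab⟩ := h1
  refine .of_mul_eq_one_right (AdjoinRoot.mk x a) ?_
  have := congrArg (AdjoinRoot.mk x) hab
  simpa using this

variable [Fintype F]

lemma lCoeff_twistedChar_eq_pow_mul (χ : MulChar (AdjoinRoot x) ℂ) (z : ℂ) (n : ℕ) :
    lCoeff (twistedChar x χ z) n = z ^ n * lCoeff (twistedChar x χ 1) n := by
  rw [lCoeff, lCoeff, Finset.mul_sum]
  refine Finset.sum_congr rfl fun f hf => ?_
  rw [twistedChar, twistedChar, (mem_monicsOfDegree.1 hf).2, one_pow, one_mul]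

lemma eval_twistedL {χ : MulChar (AdjoinRoot x) ℂ} (hχ : χ ≠ 1) (z w : ℂ) :
    (twistedL x χ z).eval w = (twistedL x χ 1).eval (z * w) := by
  simp only [twistedL, if_neg hχ, eval_finsetSum, eval_monomial]
  refine Finset.sum_congr rfl fun n _ => ?_
  rw [lCoeff_twistedChar_eq_pow_mul, mul_pow]
  ring

lemma coeff_zero_twistedL [Finite (AdjoinRoot x)] (hx : x ≠ 0) {χ : MulChar (AdjoinRoot x) ℂ}
    (hχ : χ ≠ 1) (z : ℂ) : (twistedL x χ z).coeff 0 = 1 := by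
  rw [← Polynomial.coeff_coe, coe_twistedL hx hχ, PowerSeries.coeff_mk, lCoeff_twistedChar_zero]

open scoped ComplexOrder in
theorem eval_twistedL_ne_zero [Finite (AdjoinRoot x)] (hx : x ≠ 0) {ζ : ℂ} {N : ℕ} (hN : 0 < N)
    (hζ : IsPrimitiveRoot ζ N) {χ : MulChar (AdjoinRoot x) ℂ} (hχ : χ ≠ 1) (j : ℕ) :
    (twistedL x χ (ζ ^ j)).eval (Fintype.card F : ℂ)⁻¹ ≠ 0 := by
  classical
  have : NeZero N := ⟨hN.ne'⟩
  have := Fintype.ofFinite (MulChar (AdjoinRoot x) ℂ)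
  have hq : (Fintype.card F : ℂ) ≠ 0 := by exact_mod_cast Fintype.card_ne_zero
  have hζ0 : ζ ≠ 0 := hζ.ne_zero hN.ne'
  let ι := MulChar (AdjoinRoot x) ℂ × Fin N
  let T : Finset ι := Finset.univ.filter fun i => i.1 = 1
  let S : Finset ι := Finset.univ.filter fun i => i.1 ≠ 1
  let c : ι → ℕ → ℂ := fun i => vonMangoldtCoeff (twistedChar x i.1 (ζ ^ (i.2 : ℕ)))
  have hsum : ∀ n, ∑ i ∈ S, c i n + ∑ i ∈ T, c i n = (if N ∣ n then (N : ℂ) else 0) *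
      ∑ p ∈ primePowersOfDegree F n, (p.1.natDegree : ℂ) * charSum x 1 (p.1 ^ p.2) := by
    intro n
    have h := sum_vonMangoldtCoeff (x := x) 1 hζ 0 n
    rw [add_zero] at h
    rw [← h, add_comm, Finset.sum_filter_add_sum_filter_not]
    exact Finset.sum_congr rfl fun i _ => by simp [c]
  have hterm : ∀ p : F[X] × ℕ, 0 ≤ (p.1.natDegree : ℂ) * charSum x 1 (p.1 ^ p.2) := fun p =>
    mul_nonneg (Nat.cast_nonneg _) (charSum_nonneg isUnit_one _)
  have key := exists_eval_ne_zero S T (fun i => twistedL x i.1 (ζ ^ (i.2 : ℕ))) c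
    (fun i => Fintype.card F * ζ ^ (i.2 : ℕ)) (fun t _ => mul_ne_zero hq (pow_ne_zero _ hζ0))
    ?_ ?_ ?_ ?_ ?_ ?_ ?_
  · obtain ⟨t, -, hne⟩ := key
    let k : Fin N := Fin.ofNat N (j + t.2)
    have hk : ζ ^ (k : ℕ) = ζ ^ (j + t.2) := by
      rw [Fin.val_ofNat]
      conv_rhs => rw [← Nat.mod_add_div (j + t.2) N, pow_add, pow_mul, hζ.pow_eq_one, one_pow,
        mul_one]
    have h1 := hne (χ, k) (by simp [S, hχ])
    rw [eval_twistedL hχ] at h1 ⊢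
    convert h1 using 2
    have : ζ ^ (t.2 : ℕ) ≠ 0 := pow_ne_zero _ hζ0
    rw [hk, pow_add]
    field_simp
  · rintro ⟨χ₁, j₁⟩ h₁ ⟨χ₂, j₂⟩ h₂ h
    simp only [T, Finset.coe_filter, Finset.mem_univ, true_and, Set.mem_ofPred_eq] at h₁ h₂
    rw [h₁, h₂, Prod.mk.injEq]
    exact ⟨rfl, Fin.ext (hζ.pow_inj j₁.2 j₂.2 (mul_left_cancel₀ hq h))⟩
  · rintro ⟨χ₁, j₁⟩ h₁
    simp only [T, Finset.mem_filter, Finset.mem_univ, true_and] at h₁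
    subst h₁
    exact twistedL_one x _
  · rintro ⟨χ₁, j₁⟩ h₁
    simp only [S, Finset.mem_filter, Finset.mem_univ, true_and] at h₁
    exact coeff_zero_twistedL hx h₁ _
  · rintro ⟨χ₁, j₁⟩ h₁
    simp only [T, Finset.mem_filter, Finset.mem_univ, true_and] at h₁
    subst h₁
    exact mk_vonMangoldtCoeff_mul_twistedL_one x _
  · rintro ⟨χ₁, j₁⟩ h₁
    simp only [S, Finset.mem_filter, Finset.mem_univ, true_and] at h₁
    exact mk_vonMangoldtCoeff_mul_twistedL hx h₁ _
  · intro n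
    rw [hsum]
    refine mul_nonneg ?_ (Finset.sum_nonneg fun p _ => hterm p)
    split_ifs
    · exact Nat.cast_nonneg _
    · exact le_rfl
  · intro m
    obtain ⟨n, hmn, hdvd, hpos⟩ := exists_charSum_X_pow_pos (x := x) hN m
    refine ⟨n, hmn, ?_⟩
    rw [hsum, if_pos hdvd]
    refine mul_ne_zero (by exact_mod_cast hN.ne') (ne_of_gt ?_)
    refine Finset.sum_pos' (fun p _ => hterm p) ⟨(X, n), ?_, ?_⟩
    · rw [mem_primePowersOfDegree]
      exact ⟨monic_X, irreducible_X, by omega, by simp⟩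
    · simpa using hpos

lemma card_filter_primePowersOfDegree_le (n : ℕ) :
    ((primePowersOfDegree F n).filter fun p => 2 ≤ p.2).card ≤
      (n / 2 + 1) * Fintype.card F ^ (n / 2) := by
  classical
  calc _ ≤ ((Finset.range (n / 2 + 1)).biUnion (monicsOfDegree F)).card := by
        refine Finset.card_le_card_of_injOn Prod.fst ?_ ?_
        · intro p hp
          rw [Finset.mem_coe, Finset.mem_filter, mem_primePowersOfDegree] at hp
          rw [Finset.mem_coe, Finset.mem_biUnion]
          refine ⟨p.1.natDegree, ?_, mem_monicsOfDegree.2 ⟨hp.1.1, rfl⟩⟩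
          rw [Finset.mem_range, Nat.lt_succ_iff, Nat.le_div_iff_mul_le two_pos, ← hp.1.2.2.2,
            mul_comm]
          exact Nat.mul_le_mul_right _ hp.2
        · rintro ⟨P, k⟩ hp ⟨P', k'⟩ hp' h
          dsimp only at h
          subst h
          rw [Finset.mem_coe, Finset.mem_filter, mem_primePowersOfDegree] at hp hp'
          have := hp.1.2.2.2.trans hp'.1.2.2.2.symm
          exact Prod.ext rfl (Nat.eq_of_mul_eq_mul_right hp.1.2.1.natDegree_pos this)
    _ ≤ ∑ d ∈ Finset.range (n / 2 + 1), (monicsOfDegree F d).card := Finset.card_biUnion_le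
    _ ≤ ∑ d ∈ Finset.range (n / 2 + 1), Fintype.card F ^ (n / 2) := by
        refine Finset.sum_le_sum fun d hd => ?_
        rw [card_monicsOfDegree]
        exact Nat.pow_le_pow_right Fintype.card_pos (Nat.lt_succ_iff.1 (Finset.mem_range.1 hd))
    _ = _ := by simp

lemma norm_sum_charSum_le [Finite (AdjoinRoot x)] [Fintype (MulChar (AdjoinRoot x) ℂ)]
    (hx : x ≠ 0) {u : AdjoinRoot x} (hu : IsUnit u) {N s n : ℕ}
    (h : ∀ P : F[X], Irreducible P → N ∣ P.natDegree + s → u * AdjoinRoot.mk x P ≠ 1)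
    (hn : x.natDegree < n) (hdvd : N ∣ n + s) :
    ‖∑ p ∈ primePowersOfDegree F n, (p.1.natDegree : ℂ) * charSum x u (p.1 ^ p.2)‖ ≤
      2 * Fintype.card (MulChar (AdjoinRoot x) ℂ) * (n ^ 2 * Fintype.card F ^ (n / 2)) := by
  rw [← Finset.sum_filter_of_ne (p := fun p => 2 ≤ p.2)]
  · refine (norm_sum_le_of_le _ (n := fun _ => (n * Fintype.card (MulChar (AdjoinRoot x) ℂ) : ℝ))
      fun p hp => ?_).trans ?_
    · rw [Finset.mem_filter, mem_primePowersOfDegree] at hp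
      rw [norm_mul, Complex.norm_natCast]
      refine mul_le_mul ?_ (norm_charSum_le hu _) (norm_nonneg _) (Nat.cast_nonneg _)
      rw [← hp.1.2.2.2]
      exact_mod_cast Nat.le_mul_of_pos_left _ hp.1.2.2.1
    · rw [Finset.sum_const, nsmul_eq_mul]
      have h1 : (((primePowersOfDegree F n).filter fun p => 2 ≤ p.2).card : ℝ) ≤
          2 * n * Fintype.card F ^ (n / 2) := by
        have h2 := card_filter_primePowersOfDegree_le (F := F) n
        have h3 : n / 2 + 1 ≤ 2 * n := by omega
        exact_mod_cast h2.trans (Nat.mul_le_mul_right _ h3)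
      calc _ ≤ (2 * n * Fintype.card F ^ (n / 2) : ℝ) *
            (n * Fintype.card (MulChar (AdjoinRoot x) ℂ)) := by gcongr
        _ = _ := by ring
  · intro p hp hne
    rw [mem_primePowersOfDegree] at hp
    obtain ⟨hm, hi, hk, hd⟩ := hp
    by_contra hlt
    have hk1 : p.2 = 1 := by omega
    rw [hk1, one_mul] at hd
    refine hne ?_
    rw [hk1, pow_one, charSum_eq_zero (isUnit_mk_of_natDegree_lt hx hi (hd ▸ hn))
      (h _ hi (hd ▸ hdvd)), mul_zero]

lemma summable_charSum [Finite (AdjoinRoot x)] [Fintype (MulChar (AdjoinRoot x) ℂ)]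
    (hx : x ≠ 0) {u : AdjoinRoot x} (hu : IsUnit u) {N s : ℕ}
    (h : ∀ P : F[X], Irreducible P → N ∣ P.natDegree + s → u * AdjoinRoot.mk x P ≠ 1) :
    Summable fun n => ‖(if N ∣ n + s then (N : ℂ) else 0) *
      (∑ p ∈ primePowersOfDegree F n, (p.1.natDegree : ℂ) * charSum x u (p.1 ^ p.2)) *
      (Fintype.card F : ℂ)⁻¹ ^ n‖ := by
  set q : ℝ := (Fintype.card F : ℝ) with hq
  have hq1 : 1 < q := by
    rw [hq]
    exact_mod_cast Fintype.one_lt_card (α := F)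
  have hq0 : 0 < q := by linarith
  have hgeom : Summable fun n : ℕ => (n : ℝ) ^ 2 * (√q)⁻¹ ^ n := by
    refine summable_pow_mul_geometric_of_norm_lt_one 2 ?_
    rw [norm_inv, Real.norm_of_nonneg (Real.sqrt_nonneg _)]
    exact inv_lt_one_of_one_lt₀ (Real.lt_sqrt_of_sq_lt (by linarith))
  refine .of_norm_bounded_eventually_nat
    (hgeom.mul_left ((N : ℝ) * (2 * Fintype.card (MulChar (AdjoinRoot x) ℂ)))) ?_
  filter_upwards [Filter.eventually_gt_atTop x.natDegree] with n hn
  rw [norm_norm, norm_mul, norm_mul, norm_pow, norm_inv, Complex.norm_natCast, ← hq]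
  split_ifs with hdvd
  · have h1 := norm_sum_charSum_le hx hu h hn hdvd
    have h2 : q ^ (n / 2) * q⁻¹ ^ n ≤ (√q)⁻¹ ^ n := by
      have h3 : q = √q ^ 2 := (Real.sq_sqrt hq0.le).symm
      have h4 : 1 ≤ √q := Real.one_le_sqrt.2 hq1.le
      calc q ^ (n / 2) * q⁻¹ ^ n = √q ^ (2 * (n / 2)) * ((√q)⁻¹ ^ n * (√q)⁻¹ ^ n) := by
            rw [pow_mul, ← h3, ← mul_pow, ← mul_inv, ← sq, ← h3]
        _ ≤ √q ^ n * ((√q)⁻¹ ^ n * (√q)⁻¹ ^ n) := by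
            gcongr
            omega
        _ = (√q)⁻¹ ^ n := by
            rw [← mul_assoc, ← mul_pow, mul_inv_cancel₀ (by positivity), one_pow, one_mul]
    rw [Complex.norm_natCast]
    calc
      _ ≤ N * (2 * Fintype.card (MulChar (AdjoinRoot x) ℂ) * (n ^ 2 * q ^ (n / 2))) *
          q⁻¹ ^ n := by gcongr
      _ = N * (2 * Fintype.card (MulChar (AdjoinRoot x) ℂ)) * (n ^ 2 * (q ^ (n / 2) *
          q⁻¹ ^ n)) := by ring
      _ ≤ _ := by gcongr
  · rw [norm_zero, zero_mul, zero_mul]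
    positivity

/-- The Dirichlet theorem for polynomials over a finite field, with a congruence condition on
the degree. -/
theorem exists_irreducible_dvd_sub (hx : 0 < x.natDegree) {a : F[X]} (ha : IsCoprime a x)
    (N s : ℕ) (hN : 0 < N) : ∃ P, Irreducible P ∧ x ∣ P - a ∧ N ∣ P.natDegree + s := by
  classical
  by_contra! hcon
  have hx0 : x ≠ 0 := by rintro rfl; simp at hx
  have := (AdjoinRoot.powerBasis hx0).finite
  have : Finite (AdjoinRoot x) := Module.finite_of_finite F
  have := Fintype.ofFinite (MulChar (AdjoinRoot x) ℂ)
  have : NeZero N := ⟨hN.ne'⟩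
  have hq : (Fintype.card F : ℂ) ≠ 0 := by exact_mod_cast Fintype.card_ne_zero
  have hζ := Complex.isPrimitiveRoot_exp N hN.ne'
  set ζ := Complex.exp (2 * Real.pi * Complex.I / N)
  obtain ⟨b, c, hbc⟩ := ha
  have hba : AdjoinRoot.mk x b * AdjoinRoot.mk x a = 1 := by
    simpa using congrArg (AdjoinRoot.mk x) hbc
  have hu : IsUnit (AdjoinRoot.mk x b) := .of_mul_eq_one _ hba
  refine not_summable_logDeriv ((1, 0) : MulChar (AdjoinRoot x) ℂ × Fin N)
    (fun i => twistedL x i.1 (ζ ^ (i.2 : ℕ)))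
    (fun i => vonMangoldtCoeff (twistedChar x i.1 (ζ ^ (i.2 : ℕ))))
    (fun i => if i.1 = 1 then -1 else 1)
    (fun i => i.1 (AdjoinRoot.mk x b) * (ζ ^ (i.2 : ℕ)) ^ s) (inv_ne_zero hq) ?_ ?_ ?_ ?_ ?_ ?_ ?_
  · rintro ⟨χ, j⟩
    by_cases h : χ = 1
    · subst h
      simpa using mk_vonMangoldtCoeff_mul_twistedL_one x (ζ ^ (j : ℕ))
    · simpa [h] using mk_vonMangoldtCoeff_mul_twistedL hx0 h (ζ ^ (j : ℕ))
  · simp [twistedL_one, hq]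
  · simp [twistedL_one, hq]
  · simp
  · simp [MulChar.one_apply hu]
  · rintro ⟨χ, j⟩ hne
    by_cases h : χ = 1
    · subst h
      have hj : (j : ℕ) ≠ 0 := fun hj => hne (by rw [Fin.ext (a := j) (b := 0) (by simpa using hj)])
      have := hζ.pow_ne_one_of_pos_of_lt hj j.2
      simpa [twistedL_one, hq, mul_right_comm _ _ (Fintype.card F : ℂ)⁻¹, sub_eq_zero]
        using this.symm
    · exact eval_twistedL_ne_zero hx0 hN hζ h _
  · simp_rw [sum_vonMangoldtCoeff (AdjoinRoot.mk x b) hζ s]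
    exact summable_charSum hx0 hu fun P hP h1 h2 => hcon P hP (by
      rw [← AdjoinRoot.mk_eq_mk]
      calc AdjoinRoot.mk x P = AdjoinRoot.mk x b * AdjoinRoot.mk x P * AdjoinRoot.mk x a := by
            rw [mul_right_comm, hba, one_mul]
        _ = AdjoinRoot.mk x a := by rw [h2, one_mul]) h1

end Dirichlet

section Membership

variable {R : Type*} [CommRing R]

@[simp] lemma m₁₂_zero : m₁₂ (0 : R) = 1 := by
  simp [m₁₂, Matrix.one_fin_two]

@[simp] lemma m₂₁_zero : m₂₁ (0 : R) = 1 := by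
  simp [m₂₁, Matrix.one_fin_two]

lemma Fmat_zero (r : ℕ) : Fmat r (0 : Fin r → R) = 1 := by
  simp [Fmat]

lemma Jmat_mul_inv : Jmat R * (Jmat R)⁻¹ = 1 :=
  Matrix.mul_nonsing_inv _ (by simp [Jmat, Matrix.det_fin_two_of])

lemma one_mem_FSet (r : ℕ) : (1 : Matrix (Fin 2) (Fin 2) R) ∈ FSet R r :=
  ⟨0, Fmat_zero r⟩

lemma one_mem_GSet (r : ℕ) : (1 : Matrix (Fin 2) (Fin 2) R) ∈ GSet R r :=
  ⟨0, by simp only [Gmat, Fmat_zero, mul_one, Jmat_mul_inv]⟩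

lemma m₂₁_mem_GSet {r : ℕ} (a : R) : m₂₁ a ∈ GSet R (r + 1) := by
  refine ⟨Fin.cons (-a) 0, ?_⟩
  have hF : Fmat (r + 1) (Fin.cons (-a) 0) = m₁₂ (-a) := by
    simp [Fmat, List.finRange_succ, Function.comp_def]
  have hJ : Jmat R * m₁₂ (-a) = m₂₁ a * Jmat R := by
    ext i j
    fin_cases i <;> fin_cases j <;> simp [Jmat, m₁₂, m₂₁, Matrix.mul_apply, Fin.sum_univ_two]
  simp only [Gmat]
  rw [hF, hJ, mul_assoc, Jmat_mul_inv, mul_one]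

lemma prod_mem_FSet (a₁ a₂ a₃ a₄ a₅ a₆ a₇ : R) :
    m₁₂ a₁ * m₂₁ a₂ * m₁₂ a₃ * m₂₁ a₄ * m₁₂ a₅ * m₂₁ a₆ * m₁₂ a₇ ∈ FSet R 11 := by
  refine ⟨![a₁, a₂, a₃, a₄, a₅, a₆, a₇, 0, 0, 0, 0], ?_⟩
  simp [Fmat, List.finRange_succ, mul_assoc]

lemma one_mem_MLambda : (1 : Matrix (Fin 2) (Fin 2) R) ∈ MLambda R :=
  ⟨0, 0, 0, 0, 0, by simp, by simp [Matrix.one_fin_two]⟩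

lemma one_mem_MLambdaT : (1 : Matrix (Fin 2) (Fin 2) R) ∈ MLambdaT R :=
  ⟨1, one_mem_MLambda, by simp⟩

end Membership

/-- Two determinant one matrices whose first rows `(x, b)`, `(s, b)` satisfy `b ∣ x - s` differ by
lower triangular factors. -/
lemma eq_lower_mul_mul_lower {R : Type*} [CommRing R] {x s b y y' d d' c : R}
    (h : x * d - b * y = 1) (h' : s * d' - b * y' = 1) (hc : x - s = b * c) :
    !![x, b; y, d] = m₂₁ (y * d' - d * y' - c * d * d') * !![s, b; y', d'] * m₂₁ c := by
  obtain rfl : x = s + b * c := by linear_combination hc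
  ext i j
  fin_cases i <;> fin_cases j <;> simp [m₂₁, Matrix.mul_apply, Fin.sum_univ_two]
  · linear_combination (-y) * h' + (y' + c * d') * h
  · linear_combination (-d) * h' + d' * h

/-- The matrices with nonconstant corner: after moving `b` and `y` within their residue classes
modulo `x`, both become irreducible and a power map kills the obstruction. -/
lemma exists_MLambda_factorization {F : Type*} [Field F] [Fintype F] (hq : Odd (Fintype.card F))
    {x b y d : F[X]} (h : x * d - b * y = 1) (hx : 0 < x.natDegree) :
    ∃ χ ∈ GSet F[X] 9, ∃ γ ∈ MLambdaT F[X], ∃ β ∈ MLambda F[X], ∃ η ∈ FSet F[X] 11,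
      !![x, b; y, d] = χ * γ * β * η := by
  obtain ⟨B, hB, ⟨l, hl⟩, -⟩ := exists_irreducible_dvd_sub hx
    (⟨-y, d, by linear_combination h⟩ : IsCoprime b x) 1 0 one_pos
  obtain rfl : B = b + x * l := by linear_combination hl
  have hqpos : 0 < Fintype.card F - 1 := Nat.sub_pos_of_lt Fintype.one_lt_card
  have hN : 0 < (b + x * l).natDegree * (Fintype.card F - 1) := Nat.mul_pos hB.natDegree_pos hqpos
  set N := (b + x * l).natDegree * (Fintype.card F - 1) with hN'
  obtain ⟨Y, hY, ⟨k, hk⟩, hdeg⟩ := exists_irreducible_dvd_sub hx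
    (⟨-b, d, by linear_combination h⟩ : IsCoprime y x) N (N - 1) hN
  obtain rfl : Y = y + x * k := by linear_combination hk
  obtain ⟨n, hn⟩ : ∃ n, (y + x * k).natDegree = n + 1 :=
    Nat.exists_eq_succ_of_ne_zero hY.natDegree_pos.ne'
  have hNn : N ∣ n := by
    have : (y + x * k).natDegree + (N - 1) = n + N := by omega
    rwa [this, Nat.dvd_add_self_right] at hdeg
  have hdet : x * (d + k * b + l * (y + x * k)) - (b + x * l) * (y + x * k) = 1 := by
    linear_combination h
  have hxB : ¬ (b + x * l) ∣ x := fun hd => hB.not_isUnit <| isUnit_of_dvd_one <| by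
    rw [← hdet]
    exact dvd_sub (hd.mul_right _) (Dvd.intro _ rfl)
  have hxY : ¬ (y + x * k) ∣ x := fun hd => hY.not_isUnit <| isUnit_of_dvd_one <| by
    rw [← hdet]
    exact dvd_sub (hd.mul_right _) (Dvd.intro_left _ rfl)
  have hm : Odd (∑ i ∈ Finset.range (n + 1), Fintype.card F ^ i) := by
    have hn2 : Even n := (even_iff_two_dvd.mp
      ((Nat.Odd.sub_odd hq odd_one).mul_left _)).trans hNn |> even_iff_two_dvd.mpr
    have : ∀ i ∈ Finset.range (n + 1), Odd (Fintype.card F ^ i) := fun i _ => hq.pow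
    rw [Finset.odd_sum_iff_odd_card_odd, Finset.filter_true_of_mem this, Finset.card_range]
    exact hn2.add_one
  obtain ⟨s, s', g, hs, hsdet, γ, hγ, β, hβ, hZ⟩ := exists_MLambda_swap hdet hm
  obtain ⟨z, hz, hzY⟩ := exists_dvd_pow_geom_sum_sub_C hY hxY
  rw [hn] at hzY
  obtain ⟨c, hc⟩ : (b + x * l) ∣ x - s := by
    have := dvd_sub ((dvd_mul_right _ _).trans hs) (dvd_pow_geom_sum_sub_self hB hxB hNn)
    simpa using this
  obtain ⟨e, he⟩ : (y + x * k) ∣ s - C z := by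
    have := dvd_sub hzY ((dvd_mul_left _ _).trans hs)
    simpa using this
  have h1 := eq_lower_mul_mul_lower hdet hsdet hc
  have hzz : (C z : F[X]) * C z⁻¹ = 1 := by rw [← C_mul, mul_inv_cancel₀ hz, C_1]
  have h2 := eq_prod_elementary_of_corner_unit hzz
    (show C z * s' - ((b + x * l) * g ^ 2 - e * s') * (y + x * k) = 1 by
      linear_combination hsdet - s' * he)
  have h3 : !![s, (b + x * l) * g ^ 2; y + x * k, s'] =
      m₁₂ e * !![C z, (b + x * l) * g ^ 2 - e * s'; y + x * k, s'] := by
    refine Matrix.ext fun i j => ?_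
    fin_cases i <;> fin_cases j <;> simp [m₁₂, Matrix.mul_apply, Fin.sum_univ_two]
    linear_combination he
  have h4 : !![x, b; y, d] = m₂₁ (-k) *
      !![x, b + x * l; y + x * k, d + k * b + l * (y + x * k)] * m₁₂ (-l) := by
    refine Matrix.ext fun i j => ?_
    fin_cases i <;> fin_cases j <;> simp [m₁₂, m₂₁, Matrix.mul_apply, Fin.sum_univ_two] <;> ring
  have h5 : ∀ a a' : F[X], m₂₁ a * m₂₁ a' = m₂₁ (a + a') := fun a a' => by
    simp [m₂₁]
  refine ⟨_, m₂₁_mem_GSet (-k + ((y + x * k) * s' - (d + k * b + l * (y + x * k)) *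
      ((y + x * k) * g ^ 2) - c * (d + k * b + l * (y + x * k)) * s')), γ, hγ, β, hβ, _,
    prod_mem_FSet e ((y + x * k - (C z - 1)) * C z⁻¹) 1 (C z - 1)
      (((b + x * l) * g ^ 2 - e * s' - 1) * C z⁻¹) c (-l), ?_⟩
  rw [h4, h1, hZ, h3, h2]
  simp only [← mul_assoc, h5]

lemma sl2_decomposition_of_shape {F : Type*} [Field F] {α χ γ β η : Matrix (Fin 2) (Fin 2) F[X]}
    (hχ : χ ∈ GSet F[X] 9) (hγ : γ ∈ MLambdaT F[X]) (hβ : β ∈ MLambda F[X])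
    (hη : η ∈ FSet F[X] 11) (h : α = χ * γ * β * η) :
    ∃ χ₄ ∈ GSet (Polynomial F) 4, ∃ χ₉ ∈ GSet (Polynomial F) 9,
      ∃ χ₄h ∈ FSet (Polynomial F) 4, ∃ χ₁₁h ∈ FSet (Polynomial F) 11,
        ∃ χ₄s ∈ GSet (Polynomial F) 4,
          ∃ γh ∈ MLambda (Polynomial F), ∃ β ∈ MLambda (Polynomial F),
            ∃ γ ∈ MLambdaT (Polynomial F), ∃ βh ∈ MLambdaT (Polynomial F),
              α = χ₉ * γ * χ₄ * β * χ₁₁h * γh * χ₄h * βh * χ₄s :=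
  ⟨1, one_mem_GSet 4, χ, hχ, 1, one_mem_FSet 4, η, hη, 1, one_mem_GSet 4, 1, one_mem_MLambda,
    β, hβ, γ, hγ, 1, one_mem_MLambdaT, by simpa only [mul_one] using h⟩

/-- Lemma 3.7: with `A = 𝔽_q[T]` (`q` a power of an odd prime), every `α ∈ SL₂(A)` can
be represented as `α = χ₉ · γ · χ₄ · β · χ₁₁♡ · γ♡ · χ₄♡ · β♡ · χ₄#` with
`χ₄ ∈ G₄(A⁴)`, `χ₉ ∈ G₉(A⁹)`, `χ₄♡ ∈ F₄(A⁴)`, `χ₁₁♡ ∈ F₁₁(A¹¹)`, `χ₄# ∈ G₄(A⁴)`,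
`γ♡, β ∈ M_Λ`, and `γ, β♡ ∈ M_Λᵀ`. -/
theorem sl2_decomposition
    (F : Type) [Field F] [Fintype F] (hq : Odd (Fintype.card F))
    (α : Matrix (Fin 2) (Fin 2) (Polynomial F)) (hα : α.det = 1) :
    ∃ χ₄ ∈ GSet (Polynomial F) 4, ∃ χ₉ ∈ GSet (Polynomial F) 9,
      ∃ χ₄h ∈ FSet (Polynomial F) 4, ∃ χ₁₁h ∈ FSet (Polynomial F) 11,
        ∃ χ₄s ∈ GSet (Polynomial F) 4,
          ∃ γh ∈ MLambda (Polynomial F), ∃ β ∈ MLambda (Polynomial F),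
            ∃ γ ∈ MLambdaT (Polynomial F), ∃ βh ∈ MLambdaT (Polynomial F),
              α = χ₉ * γ * χ₄ * β * χ₁₁h * γh * χ₄h * βh * χ₄s := by
  obtain ⟨x, b, y, d, rfl⟩ : ∃ x b y d, α = !![x, b; y, d] := ⟨_, _, _, _, Matrix.eta_fin_two α⟩
  rw [Matrix.det_fin_two_of] at hα
  rcases Nat.eq_zero_or_pos x.natDegree with hx | hx
  · refine sl2_decomposition_of_shape (one_mem_GSet 9) one_mem_MLambdaT one_mem_MLambda
      (η := !![x, b; y, d]) ?_ (by simp only [one_mul])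
    obtain ⟨z, rfl⟩ := natDegree_eq_zero.mp hx
    by_cases hz : z = 0
    · subst hz
      have hy : -b * y = 1 := by simpa using hα
      have h := eq_prod_elementary_of_corner_unit (z := y) (w := -b) (b := b + d) (y := y) (d := d)
        (by linear_combination hy) (by linear_combination hy)
      have h' : !![C 0, b; y, d] = m₁₂ (-1) * !![y, b + d; y, d] := by
        refine Matrix.ext fun i j => ?_
        fin_cases i <;> fin_cases j <;> simp [m₁₂, Matrix.mul_apply, Fin.sum_univ_two]
      rw [h', h]
      simpa only [m₁₂_zero, m₂₁_zero, mul_one, mul_assoc] using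
        prod_mem_FSet (-1 : F[X]) _ _ _ _ 0 0
    · rw [eq_prod_elementary_of_corner_unit (w := C z⁻¹)
        (by rw [← C_mul, mul_inv_cancel₀ hz, C_1]) hα]
      simpa only [m₁₂_zero, m₂₁_zero, mul_one, one_mul] using
        prod_mem_FSet (0 : F[X]) _ _ _ _ 0 0
  · obtain ⟨χ, hχ, γ, hγ, β, hβ, η, hη, h⟩ := exists_MLambda_factorization hq hα hx
    exact sl2_decomposition_of_shape hχ hγ hβ hη h
end
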